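/- Under the extension setup (S a based scheme on Z with closed subset T̃ such that the subscheme of S defined by z*T̃ is based-isomorphic to T, a based morphism i: U → S with iπ: U → S//T̃ an isomorphism, and Condition (*): |t(ui)| = 1 for all u ∈ U and t ∈ T̃), there exists an action ζ of U on T such that the scheme S on Z is isomorphic, as a based scheme, to the semidirect product U⋉_ζ T on Y×X. -/

import Mathlib

/-!
Common framework for association schemes, following the paper
"A new semidirect product for association schemes".
-/

/-- The diagonal relation `1_X` on a set `X`. -/
def diagRel (X : Type) : Set (X × X) := {w | w.1 = w.2}

/-- The transpose `s*` of a relation. -/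
def transp {X : Type} (s : Set (X × X)) : Set (X × X) := Prod.swap '' s

/-- The structure constant `a_{pqr}`: for `(x,y) ∈ r`, the number of `z` with
`(x,z) ∈ p` and `(z,y) ∈ q` (well-defined for elements of a scheme). -/
noncomputable def aC {X : Type} (p q r : Set (X × X)) : ℕ :=
  sSup {n | ∃ w ∈ r, n = Nat.card {z : X // (w.1, z) ∈ p ∧ (z, w.2) ∈ q}}

/-- `S` is an association scheme on `X`. -/
def IsScheme {X : Type} (S : Set (Set (X × X))) : Prop :=
  (∀ s ∈ S, s.Nonempty) ∧
  (∀ w : X × X, ∃! s, s ∈ S ∧ w ∈ s) ∧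
  diagRel X ∈ S ∧
  (∀ s ∈ S, transp s ∈ S) ∧
  (∀ p ∈ S, ∀ q ∈ S, ∀ r ∈ S, ∀ w ∈ r,
    Nat.card {z : X // (w.1, z) ∈ p ∧ (z, w.2) ∈ q} = aC p q r)

/-- Complex product of two relations relative to a scheme `S`:
`pq = {r ∈ S : a_{pqr} > 0}`. -/
noncomputable def cmulS {X : Type} (S : Set (Set (X × X))) (p q : Set (X × X)) :
    Set (Set (X × X)) :=
  {r | r ∈ S ∧ 0 < aC p q r}

/-- Complex product of two subsets of a scheme. -/
noncomputable def setMulS {X : Type} (S : Set (Set (X × X)))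
    (Pp Qq : Set (Set (X × X))) : Set (Set (X × X)) :=
  ⋃ p ∈ Pp, ⋃ q ∈ Qq, cmulS S p q

/-- `T` is a closed subset of the scheme `S` (i.e. `T ⊆ S` and `T*T ⊆ T`). -/
def IsClosedIn {X : Type} (S T : Set (Set (X × X))) : Prop :=
  T ⊆ S ∧ ∀ p ∈ T, ∀ q ∈ T, cmulS S (transp p) q ⊆ T

/-- `T` is a normal subset of the scheme `S` (i.e. `pT = Tp` for all `p ∈ S`). -/
noncomputable def IsNormalIn {X : Type} (S T : Set (Set (X × X))) : Prop :=
  ∀ p ∈ S, setMulS S {p} T = setMulS S T {p}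

/-- `xs = {y : (x,y) ∈ s}`. -/
def pimg {X : Type} (s : Set (X × X)) (x : X) : Set X := {y | (x, y) ∈ s}

/-- The coset `xT` of a (closed) subset `T` of a scheme. -/
def coset {X : Type} (T : Set (Set (X × X))) (x : X) : Set X :=
  {y | ∃ t ∈ T, (x, y) ∈ t}

/-- The set `X/T` of cosets. -/
def cosets {X : Type} (T : Set (Set (X × X))) : Set (Set X) :=
  {C | ∃ x, C = coset T x}

/-- The quotient relation `s^T` on cosets. -/
def quotRel {X : Type} (T : Set (Set (X × X))) (s : Set (X × X)) :
    Set (Set X × Set X) :=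
  {w | ∃ x₁ x₂, w = (coset T x₁, coset T x₂) ∧
    ∃ p ∈ s, p.1 ∈ coset T x₁ ∧ p.2 ∈ coset T x₂}

/-- The relations of the quotient scheme `S//T`. -/
def quotS {X : Type} (S T : Set (Set (X × X))) : Set (Set (Set X × Set X)) :=
  {r | ∃ s ∈ S, r = quotRel T s}

/-- A presentation of a (based) scheme: a set of points inside an ambient type,
a set of relations, and a basepoint. -/
structure Pres (P : Type) where
  pts : Set P
  rels : Set (Set (P × P))
  base : P

/-- A scheme `S` on the whole of `X`, based at `x0`, as a presentation. -/
def fullPres {X : Type} (S : Set (Set (X × X))) (x0 : X) : Pres X :=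
  ⟨Set.univ, S, x0⟩

/-- The quotient scheme `S//T` on `X/T`, based at `x0 T`, as a presentation. -/
def quotPres {X : Type} (S T : Set (Set (X × X))) (x0 : X) : Pres (Set X) :=
  ⟨cosets T, quotS S T, coset T x0⟩

/-- The subscheme of a scheme defined by the coset `xT` of a closed subset `T`,
as a presentation. -/
def subPres {X : Type} (T : Set (Set (X × X))) (x : X) : Pres X :=
  ⟨coset T x, {r | ∃ t ∈ T, r = t ∩ (coset T x ×ˢ coset T x)}, x⟩

/-- `f` is a morphism of schemes between two presentations: it maps points to
points, and pairs lying in the same relation to pairs lying in the same relation. -/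
def IsMorOn {P Q : Type} (A : Pres P) (B : Pres Q) (f : P → Q) : Prop :=
  Set.MapsTo f A.pts B.pts ∧
  ∀ s ∈ A.rels, ∀ w ∈ s, ∀ w' ∈ s,
    ∃ t ∈ B.rels, (f w.1, f w.2) ∈ t ∧ (f w'.1, f w'.2) ∈ t

/-- The induced map on scheme elements sends `s` to `t` (i.e. `s φ_S = t`):
every pair of `s` is mapped into `t`. -/
def elemMapsTo {P Q : Type} (f : P → Q) (s : Set (P × P)) (t : Set (Q × Q)) : Prop :=
  ∀ w ∈ s, (f w.1, f w.2) ∈ t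

/-- `f` is an isomorphism of schemes: a morphism which is bijective on points and
whose induced map on scheme elements is bijective. -/
def IsIsoOn {P Q : Type} (A : Pres P) (B : Pres Q) (f : P → Q) : Prop :=
  IsMorOn A B f ∧ Set.BijOn f A.pts B.pts ∧
  ∀ t ∈ B.rels, ∃! s, s ∈ A.rels ∧ elemMapsTo f s t

/-- A based isomorphism of schemes. -/
def IsBasedIsoOn {P Q : Type} (A : Pres P) (B : Pres Q) (f : P → Q) : Prop :=
  IsIsoOn A B f ∧ f A.base = B.base

/-- A based association scheme on a finite based set. -/
structure BScheme : Type 1 where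
  X : Type
  fin : Fintype X
  base : X
  S : Set (Set (X × X))
  isScheme : IsScheme S

/-- A morphism in the category 𝒞: a normal closed subset on each side together
with a based isomorphism between the corresponding quotient schemes. -/
structure HomC (A B : BScheme) where
  TN : Set (Set (A.X × A.X))
  UN : Set (Set (B.X × B.X))
  TN_cl : IsClosedIn A.S TN
  TN_n : IsNormalIn A.S TN
  UN_cl : IsClosedIn B.S UN
  UN_n : IsNormalIn B.S UN
  f : Set A.X → Set B.X
  iso : IsBasedIsoOn (quotPres A.S TN A.base) (quotPres B.S UN B.base) f

/-- `t^{T_φ} φ̃ = u^{U_φ}`: the induced map on quotient scheme elements sends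
the class of `t` to the class of `u`. -/
def elemRel {A B : BScheme} (φ : HomC A B) (t : Set (A.X × A.X))
    (u : Set (B.X × B.X)) : Prop :=
  elemMapsTo φ.f (quotRel φ.TN t) (quotRel φ.UN u)

/-- The normal closed subset `T_{φψ}` of the composite. -/
def Tcomp {A B C : BScheme} (φ : HomC A B) (ψ : HomC B C) :
    Set (Set (A.X × A.X)) :=
  {t | t ∈ A.S ∧ ∃ u ∈ B.S, elemRel φ t u ∧ elemRel ψ u (diagRel C.X)}

/-- The normal closed subset `V_{φψ}` of the composite. -/
def Vcomp {A B C : BScheme} (φ : HomC A B) (ψ : HomC B C) :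
    Set (Set (C.X × C.X)) :=
  {v | v ∈ C.S ∧ ∃ u ∈ B.S, elemRel φ (diagRel A.X) u ∧ elemRel ψ u v}

/-- `ρ` is a composite of `φ` and `ψ` in the category 𝒞. -/
def IsComposite {A B C : BScheme} (φ : HomC A B) (ψ : HomC B C) (ρ : HomC A C) : Prop :=
  ρ.TN = Tcomp φ ψ ∧ ρ.UN = Vcomp φ ψ ∧
  ∀ (x : A.X) (y : B.X) (z : C.X),
    φ.f (coset φ.TN x) = coset φ.UN y →
    ψ.f (coset ψ.TN y) = coset ψ.UN z →
    ρ.f (coset (Tcomp φ ψ) x) = coset (Vcomp φ ψ) z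

/-- The identity morphism of 𝒞 at `A`: both normal closed subsets are `{1_X}`
and the isomorphism is the identity of `A//{1_X}`. -/
def IsIdHom {A : BScheme} (ι : HomC A A) : Prop :=
  ι.TN = {diagRel A.X} ∧ ι.UN = {diagRel A.X} ∧
  ∀ x : A.X, ι.f (coset {diagRel A.X} x) = coset {diagRel A.X} x

/-- A `τ_T`-scheme on the based set underlying `T`. -/
structure TauSchemeOn (T : BScheme) where
  rels : Set (Set (T.X × T.X))
  isScheme : IsScheme rels
  alpha : Set (T.X × T.X) → Set (T.X × T.X)
  alpha_bij : Set.BijOn alpha T.S rels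
  alpha_one : alpha (diagRel T.X) = diagRel T.X
  alpha_star : ∀ p ∈ T.S, alpha (transp p) = transp (alpha p)
  alpha_const : ∀ p ∈ T.S, ∀ q ∈ T.S, ∀ r ∈ T.S,
    aC p q r = aC (alpha p) (alpha q) (alpha r)

/-- The based scheme underlying a `τ`-scheme. -/
abbrev TauSchemeOn.toB {T : BScheme} (Z : TauSchemeOn T) : BScheme :=
  ⟨T.X, T.fin, T.base, Z.rels, Z.isScheme⟩

/-- An action `ζ` of a based scheme `U` on a based scheme `T`. -/
structure SchemeAction (U T : BScheme) where
  /-- the `τ`-scheme `ζ_y = (T_y, α^y)` for each `y ∈ Y` -/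
  Z : U.X → TauSchemeOn T
  /-- the morphism `ζ_{y₁}^{y₂} ∈ Hom_𝒞(T_{y₁}, T_{y₂})` -/
  hom : ∀ y1 y2 : U.X, HomC (Z y1).toB (Z y2).toB
  /-- (1) `T_{y*} = T` -/
  base_rels : (Z U.base).rels = T.S
  /-- (1) `α^{y*} = id` -/
  base_alpha : ∀ p, (Z U.base).alpha p = p
  /-- (2) `ζ_y^y` is the identity morphism -/
  hom_refl_TN : ∀ y : U.X, (hom y y).TN = {diagRel T.X}
  hom_refl_UN : ∀ y : U.X, (hom y y).UN = {diagRel T.X}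
  hom_refl_f : ∀ (y : U.X) (x : T.X),
    (hom y y).f (coset {diagRel T.X} x) = coset {diagRel T.X} x
  /-- (3) `ζ_{y₂}^{y₁} = (ζ_{y₁}^{y₂})*` -/
  hom_symm_TN : ∀ y1 y2 : U.X, (hom y2 y1).TN = (hom y1 y2).UN
  hom_symm_UN : ∀ y1 y2 : U.X, (hom y2 y1).UN = (hom y1 y2).TN
  hom_symm_f : ∀ y1 y2 : U.X,
    Set.InvOn (hom y2 y1).f (hom y1 y2).f
      (cosets (hom y1 y2).TN) (cosets (hom y1 y2).UN)
  /-- (4) `ζ_{y₁}^{y₂}(τ)` depends only on the element `u ∈ U` containing `(y₁,y₂)` -/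
  zeta_welldef : ∀ u ∈ U.S, ∀ y1 y2 y1' y2' : U.X, (y1, y2) ∈ u → (y1', y2') ∈ u →
    ∀ Pp : Set (Set (T.X × T.X)),
      {u' | u' ∈ T.S ∧ ∃ t ∈ Pp,
        elemRel (hom y1 y2) ((Z y1).alpha t) ((Z y2).alpha u')} =
      {u' | u' ∈ T.S ∧ ∃ t ∈ Pp,
        elemRel (hom y1' y2') ((Z y1').alpha t) ((Z y2').alpha u')}
  /-- (5) `ζ_{y₁}^{y₃} ≤ ζ_{y₁}^{y₂} ζ_{y₂}^{y₃}` -/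
  le_comp : ∀ y1 y2 y3 : U.X,
    (hom y1 y3).TN ⊆ Tcomp (hom y1 y2) (hom y2 y3) ∧
    (hom y1 y3).UN ⊆ Vcomp (hom y1 y2) (hom y2 y3) ∧
    ∀ x x2 x3 : T.X,
      (hom y1 y2).f (coset (hom y1 y2).TN x) = coset (hom y1 y2).UN x2 →
      (hom y2 y3).f (coset (hom y2 y3).TN x2) = coset (hom y2 y3).UN x3 →
      (hom y1 y3).f (coset (hom y1 y3).TN x) ⊆
        coset (Vcomp (hom y1 y2) (hom y2 y3)) x3

/-- The map `ζ_u` on subsets of `τ` induced by any `(y₁,y₂) ∈ u`. -/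
def SchemeAction.zetaU {U T : BScheme} (act : SchemeAction U T)
    (u : Set (U.X × U.X)) (Pp : Set (Set (T.X × T.X))) : Set (Set (T.X × T.X)) :=
  {u' | ∃ y1 y2 : U.X, (y1, y2) ∈ u ∧ u' ∈ T.S ∧
    ∃ t ∈ Pp, elemRel (act.hom y1 y2) ((act.Z y1).alpha t) ((act.Z y2).alpha u')}

/-- The relation `[u,t]` on `Y × X`. -/
def SchemeAction.rel {U T : BScheme} (act : SchemeAction U T)
    (u : Set (U.X × U.X)) (t : Set (T.X × T.X)) :
    Set ((U.X × T.X) × (U.X × T.X)) :=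
  {w | (w.1.1, w.2.1) ∈ u ∧
    ((act.hom w.1.1 w.2.1).f (coset (act.hom w.1.1 w.2.1).TN w.1.2),
      coset (act.hom w.1.1 w.2.1).UN w.2.2) ∈
      quotRel (act.hom w.1.1 w.2.1).UN ((act.Z w.2.1).alpha t)}

/-- The semidirect product `U ⋉_ζ T` as a set of relations on `Y × X`. -/
def SchemeAction.sdp {U T : BScheme} (act : SchemeAction U T) :
    Set (Set ((U.X × T.X) × (U.X × T.X))) :=
  {r | ∃ u ∈ U.S, ∃ t ∈ T.S, r = act.rel u t}

/-- The valency `n_s = a_{s s* 1}` of a relation. -/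
noncomputable def nval {X : Type} (s : Set (X × X)) : ℕ :=
  aC s (transp s) (diagRel X)


/-! ### Coloured version of the extension setup -/

/-- The extension setup, expressed through colour functions. -/
structure Ctx (Z Y X L M : Type) where
  col : Z → Z → L
  uc : Y → Y → M
  i : Y → Z
  bl : Z → Y
  e : Y → X → Z
  ei : Z → X
  x0 : X
  col_refl : ∀ a b, col a a = col b b
  col_diag : ∀ a b c, col a b = col c c → a = b
  col_symm : ∀ {a b a' b'}, col a b = col a' b' → col b a = col b' a'
  count : ∀ {a b a' b'}, col a b = col a' b' → ∀ k l,
    Nat.card {z // col a z = k ∧ col z b = l} = Nat.card {z // col a' z = k ∧ col z b' = l}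
  transfer : ∀ {a b a' b'}, col a b = col a' b' → ∀ w,
    ∃ w', col a' w' = col a w ∧ col w' b' = col w b
  bl_i : ∀ y, bl (i y) = y
  bl_col : ∀ {a b a' b'}, col a b = col a' b' → bl a = bl b → bl a' = bl b'
  uc_col : ∀ {a b a' b'}, col a b = col a' b' → uc (bl a) (bl b) = uc (bl a') (bl b')
  sig : ∀ {y1 y2 y1' y2'}, uc y1 y2 = uc y1' y2' → col (i y1) (i y2) = col (i y1') (i y2')
  star : ∀ {a w b a' w' b'}, bl a = bl w → bl a' = bl w' → col a w = col a' w' →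
    col w b = col (i (bl w)) (i (bl b)) → col w' b' = col (i (bl w')) (i (bl b')) →
    uc (bl w) (bl b) = uc (bl w') (bl b') → col a b = col a' b'
  bl_e : ∀ y x, bl (e y x) = y
  ei_e : ∀ y x, ei (e y x) = x
  e_ei : ∀ z, e (bl z) (ei z) = z
  e_base : ∀ y, e y x0 = i y

namespace Ctx

variable {Z Y X L M : Type} (K : Ctx Z Y X L M)

/-- The relation defining the morphisms of the action. -/
def R (a b : Z) : Prop := K.col a b = K.col (K.i (K.bl a)) (K.i (K.bl b))

theorem R_symm {a b : Z} (h : K.R a b) : K.R b a := K.col_symm h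

theorem R_i (y1 y2 : Y) : K.R (K.i y1) (K.i y2) := by
  simp [R, K.bl_i]

theorem uc_symm {y1 y2 y1' y2' : Y} (h : K.uc y1 y2 = K.uc y1' y2') :
    K.uc y2 y1 = K.uc y2' y1' := by
  have := K.uc_col (K.col_symm (K.sig h))
  simpa [K.bl_i] using this

theorem R_of {a b a' b' : Z} (h : K.R a b) (h' : K.col a' b' = K.col a b) : K.R a' b' := by
  have h1 := K.uc_col h'
  unfold R at *
  rw [h', h]
  exact (K.sig h1).symm

theorem R_refl {a b : Z} (hb : K.bl a = K.bl b) (h : K.R a b) : a = b := by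
  unfold R at h
  rw [hb] at h
  exact K.col_diag _ _ _ h

theorem R_self (a : Z) : K.R a a := K.col_refl _ _

theorem star' {a w b a' w' b' : Z} (h1 : K.bl a = K.bl w) (h2 : K.bl a' = K.bl w')
    (h3 : K.col a w = K.col a' w') (h4 : K.R w b) (h5 : K.R w' b')
    (h6 : K.uc (K.bl w) (K.bl b) = K.uc (K.bl w') (K.bl b')) : K.col a b = K.col a' b' :=
  K.star h1 h2 h3 h4 h5 h6

theorem row {a a' : Z} (b : Z) : ∃ b', K.col a' b' = K.col a b := by
  obtain ⟨w, h, _⟩ := K.transfer (K.col_refl a a') b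
  exact ⟨w, h⟩

theorem L1 (a : Z) (y : Y) : ∃ b, K.bl b = y ∧ K.R a b := by
  obtain ⟨z, hz⟩ := K.row (a := a) (a' := K.i (K.bl a)) (K.i y)
  have hu := K.uc_col hz
  simp only [K.bl_i] at hu
  obtain ⟨b, hb1, hb2⟩ := K.transfer hz (K.i (K.bl z))
  have hbl : K.bl b = y := by
    have := K.bl_col hb2.symm (by simp [K.bl_i])
    simpa [K.bl_i] using this
  refine ⟨b, hbl, ?_⟩
  unfold R
  rw [hb1, hbl]
  exact K.sig hu

theorem L2 {a a' b b' : Z} (ha : K.bl a = K.bl a') (hb : K.bl b = K.bl b')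
    (h1 : K.R a b) (h2 : K.R a' b) (h3 : K.R a b') : K.R a' b' := by
  have := K.star' (a := a') (w := a) (b := b) (a' := a') (w' := a) (b' := b') ha.symm ha.symm rfl
    h1 h3 (by rw [hb])
  exact K.R_of h2 this.symm

theorem L3 {a a' b c c' d : Z} (ha : K.bl a = K.bl a') (h1 : K.R a b) (h2 : K.R a' b)
    (hc : K.col a a' = K.col c c') (h3 : K.R c d)
    (hu : K.uc (K.bl a) (K.bl b) = K.uc (K.bl c) (K.bl d)) : K.R c' d := by
  have := K.star' ha.symm (K.bl_col hc ha).symm (K.col_symm hc) h1 h3 hu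
  exact K.R_of h2 this.symm

theorem L4 {a a' b b' c c' d : Z} (ha : K.bl a = K.bl a') (hb : K.bl b = K.bl b')
    (h1 : K.R a b) (h2 : K.R a' b') (hc : K.col a a' = K.col c c') (h3 : K.R c d)
    (hu : K.uc (K.bl a) (K.bl b) = K.uc (K.bl c) (K.bl d)) :
    ∃ d', K.bl d' = K.bl d ∧ K.R c' d' ∧ K.col d d' = K.col b b' := by
  have := K.star' ha.symm (K.bl_col hc ha).symm (K.col_symm hc) h1 h3 hu
  obtain ⟨d', hd1, hd2⟩ := K.transfer this b'
  exact ⟨d', K.bl_col hd2.symm hb.symm, K.R_of h2 hd1, K.col_symm hd2⟩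

/-- The correspondence between colours induced by the action. -/
def CR (y1 y2 : Y) (k k' : L) : Prop :=
  ∃ a a' b b', K.bl a = y1 ∧ K.bl a' = y1 ∧ K.bl b = y2 ∧ K.bl b' = y2 ∧ K.R a b ∧ K.R a' b' ∧
    K.col a a' = k ∧ K.col b b' = k'

theorem CR_symm {y1 y2 : Y} {k k' : L} (h : K.CR y1 y2 k k') : K.CR y2 y1 k' k := by
  obtain ⟨a, a', b, b', h1, h2, h3, h4, h5, h6, h7, h8⟩ := h
  exact ⟨b, b', a, a', h3, h4, h1, h2, K.R_symm h5, K.R_symm h6, h8, h7⟩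

theorem CR_ext {y1 y2 : Y} {k k' : L} (h : K.CR y1 y2 k k') {c c' d : Z}
    (hu : K.uc y1 y2 = K.uc (K.bl c) (K.bl d)) (hk : K.col c c' = k) (hR : K.R c d) :
    ∃ d', K.bl d' = K.bl d ∧ K.R c' d' ∧ K.col d d' = k' := by
  obtain ⟨a, a', b, b', h1, h2, h3, h4, h5, h6, h7, h8⟩ := h
  subst h1
  subst h3
  obtain ⟨d', q1, q2, q3⟩ := K.L4 h2.symm h4.symm h5 h6 (h7.trans hk.symm) hR hu
  exact ⟨d', q1, q2, q3.trans h8⟩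

theorem CR_uc {y1 y2 y1' y2' : Y} {k k' : L} (hu : K.uc y1 y2 = K.uc y1' y2')
    (h : K.CR y1 y2 k k') : K.CR y1' y2' k k' := by
  have h0 := h
  obtain ⟨a, a', b, b', h1, h2, h3, h4, h5, h6, h7, h8⟩ := h
  obtain ⟨c', hc'⟩ := K.row (a := a) (a' := K.i y1') a'
  obtain ⟨d', q1, q2, q3⟩ := K.CR_ext h0 (c := K.i y1') (c' := c') (d := K.i y2')
    (by simpa [K.bl_i] using hu) (hc'.trans h7) (K.R_i _ _)
  refine ⟨K.i y1', c', K.i y2', d', K.bl_i _, ?_, K.bl_i _, ?_, K.R_i _ _, q2, hc'.trans h7, q3⟩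
  · have := K.bl_col hc'.symm (h1.trans h2.symm)
    rw [← this, K.bl_i]
  · rw [q1, K.bl_i]

theorem K5a {y1 y2 y3 : Y} {a a' c : Z} (ha : K.bl a = y1) (ha' : K.bl a' = y1) (hc : K.bl c = y3)
    (h1 : K.R a c) (h2 : K.R a' c) (o : Z) :
    ∃ k, K.CR y1 y2 (K.col a a') k ∧ K.CR y2 y3 k (K.col o o) := by
  subst ha
  subst hc
  obtain ⟨z, hz⟩ := K.row (a := a) (a' := K.i (K.bl a)) a'
  have hzb : K.bl z = K.bl a := by
    have := K.bl_col hz.symm ha'.symm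
    rw [← this, K.bl_i]
  have hR : K.R z (K.i (K.bl c)) := K.L3 ha'.symm h1 h2 hz.symm (K.R_i _ _) (by simp [K.bl_i])
  have hcol : K.col (K.i (K.bl a)) (K.i (K.bl c)) = K.col z (K.i (K.bl c)) := by
    have := hR
    unfold R at this
    rw [this, hzb, K.bl_i]
  obtain ⟨w, hw1, hw2⟩ := K.transfer hcol (K.i y2)
  have u1 := K.uc_col hw1
  have u2 := K.uc_col hw2
  simp only [K.bl_i] at u1 u2
  rw [hzb] at u1
  refine ⟨K.col (K.i (K.bl w)) w, K.CR_uc u1 ?_, K.CR_uc u2 ?_⟩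
  · exact ⟨K.i (K.bl a), z, K.i (K.bl w), w, K.bl_i _, hzb, K.bl_i _, rfl, K.R_i _ _,
      K.R_of (K.R_i _ _) hw1, hz, rfl⟩
  · exact ⟨K.i (K.bl w), w, K.i (K.bl c), K.i (K.bl c), K.bl_i _, rfl, K.bl_i _, K.bl_i _,
      K.R_i _ _, K.R_of (K.R_i _ _) hw2, rfl, K.col_refl _ _⟩

/-- Colours of the second normal closed subset of a composite. -/
def V (y1 y2 y3 : Y) (o : Z) (kv : L) : Prop :=
  ∃ k, K.CR y1 y2 (K.col o o) k ∧ K.CR y2 y3 k kv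

theorem V_of {y1 y2 y3 : Y} {a c c' : Z} (ha : K.bl a = y1) (hc : K.bl c = y3)
    (hc' : K.bl c' = y3) (h1 : K.R a c) (h2 : K.R a c') (o : Z) :
    K.V y1 y2 y3 o (K.col c c') := by
  obtain ⟨k, q1, q2⟩ := K.K5a (y2 := y2) hc hc' ha (K.R_symm h1) (K.R_symm h2) o
  exact ⟨k, K.CR_symm q2, K.CR_symm q1⟩

theorem V_closed {y1 y2 y3 : Y} {o a b c : Z} (ha : K.bl a = y3) (hb : K.bl b = y3)
    (hc : K.bl c = y3) (h1 : K.V y1 y2 y3 o (K.col a b)) (h2 : K.V y1 y2 y3 o (K.col a c)) :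
    K.V y1 y2 y3 o (K.col b c) := by
  obtain ⟨k1, p1, p2⟩ := h1
  obtain ⟨k2, q1, q2⟩ := h2
  obtain ⟨d, hd, hda⟩ := K.L1 a y2
  obtain ⟨e, he, hed⟩ := K.L1 d y1
  obtain ⟨d1, s1, s2, s3⟩ := K.CR_ext (K.CR_symm p2) (c := a) (c' := b) (d := d)
    (by rw [ha, hd]) rfl hda
  obtain ⟨d2, t1, t2, t3⟩ := K.CR_ext (K.CR_symm q2) (c := a) (c' := c) (d := d)
    (by rw [ha, hd]) rfl hda
  obtain ⟨e1, e11, e12, e13⟩ := K.CR_ext (K.CR_symm p1) (c := d) (c' := d1) (d := e)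
    (by rw [he, hd]) s3 hed
  obtain ⟨e2, e21, e22, e23⟩ := K.CR_ext (K.CR_symm q1) (c := d) (c' := d2) (d := e)
    (by rw [he, hd]) t3 hed
  have := K.col_diag _ _ _ e13
  subst this
  have := K.col_diag _ _ _ e23
  subst this
  exact ⟨K.col d1 d2, ⟨e, e, d1, d2, he, he, s1.trans hd, t1.trans hd, K.R_symm e12, K.R_symm e22,
    K.col_refl _ _, rfl⟩, ⟨d1, d2, b, c, s1.trans hd, t1.trans hd, hb, hc, K.R_symm s2,
    K.R_symm t2, rfl, rfl⟩⟩

theorem K5c {y1 y2 y3 : Y} {z1 z2 z3 z3' : Z} (b1 : K.bl z1 = y1) (b2 : K.bl z2 = y2)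
    (b3 : K.bl z3 = y3) (b3' : K.bl z3' = y3) (h12 : K.R z1 z2) (h23 : K.R z2 z3)
    (h13 : K.R z1 z3') (o : Z) : K.V y1 y2 y3 o (K.col z3 z3') := by
  obtain ⟨z, hz⟩ := K.row (a := z1) (a' := K.i y1) z3
  obtain ⟨w, w1, w2⟩ := K.transfer hz.symm z2
  have u1 := K.uc_col w1
  have u2 := K.uc_col w2
  have u3 := K.uc_col hz
  rw [K.bl_i, b1, b2] at u1
  rw [b3, b2] at u2
  rw [K.bl_i, b1, b3] at u3
  have hV : K.V y1 y2 y3 o (K.col (K.i (K.bl z)) z) := by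
    refine ⟨K.col (K.i (K.bl w)) w, K.CR_uc u1 ?_, K.CR_uc u2 ?_⟩
    · exact ⟨K.i y1, K.i y1, K.i (K.bl w), w, K.bl_i _, K.bl_i _, K.bl_i _, rfl, K.R_i _ _,
        K.R_of h12 w1, K.col_refl _ _, rfl⟩
    · exact ⟨_, _, _, _, K.bl_i _, rfl, K.bl_i _, rfl, K.R_i _ _, K.R_of h23 w2, rfl, rfl⟩
  obtain ⟨z', q1, q2⟩ := K.transfer hz (K.i (K.bl z))
  have hz' : K.bl z' = y3 := by
    rw [← b3]
    exact K.bl_col q2.symm (K.bl_i _)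
  rw [← q2] at hV
  exact K.V_closed hz' b3 b3' hV (K.V_of b1 hz' b3' (K.R_of (K.R_i _ _) q1) h13 o)

end Ctx

/-! ### Schemes from colourings -/

/-- The relation of colour `k`. -/
def clsk {X L : Type} (c : X → X → L) (k : L) : Set (X × X) := {w | c w.1 w.2 = k}

/-- The relations of a colouring. -/
def relsOf {X L : Type} (c : X → X → L) : Set (Set (X × X)) := {r | ∃ a b, r = clsk c (c a b)}

theorem aC_clsk {X L : Type} (c : X → X → L)
    (hcount : ∀ {a b a' b'}, c a b = c a' b' → ∀ k l,
      Nat.card {z // c a z = k ∧ c z b = l} = Nat.card {z // c a' z = k ∧ c z b' = l})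
    (a b : X) (k l : L) :
    aC (clsk c k) (clsk c l) (clsk c (c a b)) = Nat.card {z // c a z = k ∧ c z b = l} := by
  have : {n | ∃ w ∈ clsk c (c a b), n = Nat.card {z : X // (w.1, z) ∈ clsk c k ∧
      (z, w.2) ∈ clsk c l}} = {Nat.card {z // c a z = k ∧ c z b = l}} := by
    ext n
    simp only [Set.mem_ofPred_eq, Set.mem_singleton_iff]
    constructor
    · rintro ⟨w, hw, rfl⟩
      exact hcount hw k l
    · rintro rfl
      exact ⟨(a, b), rfl, rfl⟩
  unfold aC
  rw [this]
  simp

theorem aC_pos {X : Type} {p q r : Set (X × X)} (h : 0 < aC p q r) :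
    ∃ w ∈ r, ∃ z, (w.1, z) ∈ p ∧ (z, w.2) ∈ q := by
  by_contra hcon
  push Not at hcon
  have : aC p q r = 0 := by
    unfold aC
    refine Nat.le_zero.1 (csSup_le' ?_)
    rintro n ⟨w, hw, rfl⟩
    rw [Nat.le_zero, Nat.card_eq_zero]
    left
    exact ⟨fun z => hcon w hw z.1 z.2.1 z.2.2⟩
  omega

theorem mem_cmulS {X : Type} [Finite X] {S : Set (Set (X × X))} (hS : IsScheme S)
    {p q r : Set (X × X)} (hp : p ∈ S) (hq : q ∈ S) :
    r ∈ cmulS S p q ↔ r ∈ S ∧ ∃ w ∈ r, ∃ z, (w.1, z) ∈ p ∧ (z, w.2) ∈ q := by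
  constructor
  · rintro ⟨h, h'⟩
    exact ⟨h, aC_pos h'⟩
  · rintro ⟨h, w, hw, z, h1, h2⟩
    refine ⟨h, ?_⟩
    rw [← hS.2.2.2.2 p hp q hq r h w hw]
    have : Nonempty {z : X // (w.1, z) ∈ p ∧ (z, w.2) ∈ q} := ⟨⟨z, h1, h2⟩⟩
    exact Nat.card_pos

theorem mem_transp {X : Type} {s : Set (X × X)} {a b : X} : (a, b) ∈ transp s ↔ (b, a) ∈ s := by
  unfold transp
  constructor
  · rintro ⟨⟨x, y⟩, h, h'⟩
    simp only [Prod.swap_prod_mk, Prod.mk.injEq] at h'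
    obtain ⟨rfl, rfl⟩ := h'
    exact h
  · intro h
    exact ⟨(b, a), h, rfl⟩

theorem isScheme_relsOf {X L : Type} [Nonempty X] (c : X → X → L)
    (hrefl : ∀ a b, c a a = c b b) (hdiag : ∀ a b d, c a b = c d d → a = b)
    (hsymm : ∀ {a b a' b'}, c a b = c a' b' → c b a = c b' a')
    (hcount : ∀ {a b a' b'}, c a b = c a' b' → ∀ k l,
      Nat.card {z // c a z = k ∧ c z b = l} = Nat.card {z // c a' z = k ∧ c z b' = l}) :
    IsScheme (relsOf c) := by
  refine ⟨?_, ?_, ?_, ?_, ?_⟩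
  · rintro s ⟨a, b, rfl⟩
    exact ⟨(a, b), rfl⟩
  · rintro ⟨a, b⟩
    refine ⟨clsk c (c a b), ⟨⟨a, b, rfl⟩, rfl⟩, ?_⟩
    rintro s ⟨⟨a', b', rfl⟩, h⟩
    have h : c a b = c a' b' := h
    rw [h]
  · obtain ⟨x⟩ := ‹Nonempty X›
    refine ⟨x, x, ?_⟩
    ext ⟨a, b⟩
    simp only [diagRel, clsk, Set.mem_ofPred_eq]
    constructor
    · rintro rfl
      exact hrefl _ _
    · exact hdiag _ _ _
  · rintro s ⟨a, b, rfl⟩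
    refine ⟨b, a, ?_⟩
    ext ⟨a', b'⟩
    rw [mem_transp]
    simp only [clsk, Set.mem_ofPred_eq]
    exact ⟨hsymm, hsymm⟩
  · rintro p ⟨p1, p2, rfl⟩ q ⟨q1, q2, rfl⟩ r ⟨r1, r2, rfl⟩ w hw
    rw [aC_clsk c hcount]
    exact hcount hw _ _

namespace Ctx

variable {Z Y X L M : Type} (K : Ctx Z Y X L M)

/-- The colouring of `X` transported from the block of `y`. -/
def c (y : Y) (a b : X) : L := K.col (K.e y a) (K.e y b)

/-- The relation `R` in coordinates. -/
def Rx (y1 y2 : Y) (a b : X) : Prop := K.R (K.e y1 a) (K.e y2 b)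

theorem ex_e {y : Y} {z : Z} (h : K.bl z = y) : ∃ x, K.e y x = z := by
  subst h
  exact ⟨_, K.e_ei z⟩

theorem e_inj {y : Y} {a b : X} (h : K.e y a = K.e y b) : a = b := by
  rw [← K.ei_e y a, h, K.ei_e]

theorem Rx_symm {y1 y2 : Y} {a b : X} (h : K.Rx y1 y2 a b) : K.Rx y2 y1 b a := K.R_symm h

theorem Rx_self (y : Y) (a b : X) : K.Rx y y a b ↔ a = b := by
  constructor
  · intro h
    exact K.e_inj (K.R_refl (by simp [K.bl_e]) h)
  · rintro rfl
    exact K.R_self _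

theorem Rx_base (y1 y2 : Y) : K.Rx y1 y2 K.x0 K.x0 := by
  unfold Rx
  rw [K.e_base, K.e_base]
  exact K.R_i _ _

theorem X1 (y1 y2 : Y) (a : X) : ∃ b, K.Rx y1 y2 a b := by
  obtain ⟨z, h, h'⟩ := K.L1 (K.e y1 a) y2
  obtain ⟨x, rfl⟩ := K.ex_e h
  exact ⟨x, h'⟩

theorem X2 {y1 y2 : Y} {a a' b b' : X} (h1 : K.Rx y1 y2 a b) (h2 : K.Rx y1 y2 a' b)
    (h3 : K.Rx y1 y2 a b') : K.Rx y1 y2 a' b' :=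
  K.L2 (by simp [K.bl_e]) (by simp [K.bl_e]) h1 h2 h3

theorem X3 {y1 y2 : Y} {a a' b c c' d : X} (h1 : K.Rx y1 y2 a b)
    (h2 : K.Rx y1 y2 a' b) (hc : K.c y1 a a' = K.c y1 c c') (h3 : K.Rx y1 y2 c d) :
    K.Rx y1 y2 c' d :=
  K.L3 (by simp [K.bl_e]) h1 h2 hc h3 (by simp [K.bl_e])

theorem X4 {y1 y2 : Y} {a a' b b' c c' d : X} (h1 : K.Rx y1 y2 a b)
    (h2 : K.Rx y1 y2 a' b') (hc : K.c y1 a a' = K.c y1 c c') (h3 : K.Rx y1 y2 c d) :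
    ∃ d', K.Rx y1 y2 c' d' ∧ K.c y2 d d' = K.c y2 b b' := by
  obtain ⟨z, q1, q2, q3⟩ := K.L4 (by simp [K.bl_e]) (by simp [K.bl_e]) h1 h2 hc h3
    (by simp [K.bl_e])
  obtain ⟨x, rfl⟩ := K.ex_e (q1.trans (K.bl_e _ _))
  exact ⟨x, q2, q3⟩

theorem CR_iff {y1 y2 : Y} {k k' : L} : K.CR y1 y2 k k' ↔
    ∃ a a' b b', K.Rx y1 y2 a b ∧ K.Rx y1 y2 a' b' ∧ K.c y1 a a' = k ∧ K.c y2 b b' = k' := by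
  constructor
  · rintro ⟨a, a', b, b', h1, h2, h3, h4, h5, h6, h7, h8⟩
    obtain ⟨a, rfl⟩ := K.ex_e h1
    obtain ⟨a', rfl⟩ := K.ex_e h2
    obtain ⟨b, rfl⟩ := K.ex_e h3
    obtain ⟨b', rfl⟩ := K.ex_e h4
    exact ⟨a, a', b, b', h5, h6, h7, h8⟩
  · rintro ⟨a, a', b, b', h1, h2, h3, h4⟩
    exact ⟨_, _, _, _, K.bl_e _ _, K.bl_e _ _, K.bl_e _ _, K.bl_e _ _, h1, h2, h3, h4⟩

theorem c_symm {y y' : Y} {a b a' b' : X} (h : K.c y a b = K.c y' a' b') :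
    K.c y b a = K.c y' b' a' := K.col_symm h

theorem c_refl (y y' : Y) (a b : X) : K.c y a a = K.c y' b b := K.col_refl _ _

theorem c_diag {y y' : Y} {a b d : X} (h : K.c y a b = K.c y' d d) : a = b :=
  K.e_inj (K.col_diag _ _ _ h)

/-- The set of points witnessing a structure constant inside a block. -/
def cEquiv (y : Y) (a b : X) (k l : L) {p q : Z} (hpq : K.bl p = K.bl q) (hk : K.col p q = k) :
    {x // K.c y a x = k ∧ K.c y x b = l} ≃
      {z // K.col (K.e y a) z = k ∧ K.col z (K.e y b) = l} where
  toFun x := ⟨K.e y x.1, x.2⟩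
  invFun z := ⟨K.ei z.1, by
    have hb : K.bl z.1 = y := by
      have := K.bl_col (hk.trans z.2.1.symm) hpq
      rw [← this, K.bl_e]
    have he : K.e y (K.ei z.1) = z.1 := by
      have := K.e_ei z.1
      rwa [hb] at this
    unfold c
    rw [he]
    exact z.2⟩
  left_inv x := by
    apply Subtype.ext
    exact K.ei_e _ _
  right_inv z := by
    apply Subtype.ext
    have hb : K.bl z.1 = y := by
      have := K.bl_col (hk.trans z.2.1.symm) hpq
      rw [← this, K.bl_e]
    have := K.e_ei z.1
    rwa [hb] at this

theorem c_count {y y' : Y} {a b a' b' : X} (h : K.c y a b = K.c y' a' b') (k l : L) :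
    Nat.card {x // K.c y a x = k ∧ K.c y x b = l} =
      Nat.card {x // K.c y' a' x = k ∧ K.c y' x b' = l} := by
  by_cases hk : ∃ p q, K.bl p = K.bl q ∧ K.col p q = k
  · obtain ⟨p, q, h1, h2⟩ := hk
    rw [Nat.card_congr (K.cEquiv y a b k l h1 h2), Nat.card_congr (K.cEquiv y' a' b' k l h1 h2)]
    exact K.count h k l
  · have : IsEmpty {x // K.c y a x = k ∧ K.c y x b = l} :=
      ⟨fun x => hk ⟨_, _, by simp [K.bl_e], x.2.1⟩⟩
    have : IsEmpty {x // K.c y' a' x = k ∧ K.c y' x b' = l} :=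
      ⟨fun x => hk ⟨_, _, by simp [K.bl_e], x.2.1⟩⟩
    simp

theorem c_row {y : Y} (y' : Y) (a b a' : X) : ∃ b', K.c y' a' b' = K.c y a b := by
  obtain ⟨z, hz⟩ := K.row (a := K.e y a) (a' := K.e y' a') (K.e y b)
  have := K.bl_col hz.symm (by simp [K.bl_e])
  rw [K.bl_e] at this
  obtain ⟨x, rfl⟩ := K.ex_e this.symm
  exact ⟨x, hz⟩

theorem c_isScheme (y : Y) : IsScheme (relsOf (K.c y)) :=
  have : Nonempty X := ⟨K.x0⟩
  isScheme_relsOf _ (K.c_refl y y) (fun _ _ _ h => K.c_diag h) K.c_symm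
    (fun h => K.c_count h)

theorem diag_eq (y y' : Y) (x : X) : diagRel X = clsk (K.c y) (K.c y' x x) := by
  ext ⟨a, b⟩
  simp only [diagRel, clsk, Set.mem_ofPred_eq]
  constructor
  · rintro rfl
    exact K.c_refl _ _ _ _
  · exact K.c_diag

/-- The normal closed subset attached to a pair of points. -/
def TN (y1 y2 : Y) : Set (Set (X × X)) :=
  {r | r ∈ relsOf (K.c y1) ∧ ∃ w ∈ r, ∃ b, K.Rx y1 y2 w.1 b ∧ K.Rx y1 y2 w.2 b}

theorem clsk_mem_TN {y1 y2 : Y} {a a' : X} :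
    clsk (K.c y1) (K.c y1 a a') ∈ K.TN y1 y2 ↔ ∃ b, K.Rx y1 y2 a b ∧ K.Rx y1 y2 a' b := by
  constructor
  · rintro ⟨_, w, hw, b, h1, h2⟩
    obtain ⟨d, hd⟩ := K.X1 y1 y2 a
    exact ⟨d, hd, K.X3 h1 h2 hw hd⟩
  · intro h
    exact ⟨⟨_, _, rfl⟩, (a, a'), rfl, h⟩

theorem mem_coset_TN {y1 y2 : Y} {a a' : X} :
    a' ∈ coset (K.TN y1 y2) a ↔ ∃ b, K.Rx y1 y2 a b ∧ K.Rx y1 y2 a' b := by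
  rw [← K.clsk_mem_TN]
  constructor
  · rintro ⟨t, ht, h⟩
    obtain ⟨p, q, rfl⟩ := ht.1
    have h : K.c y1 a a' = K.c y1 p q := h
    rw [h]
    exact ht
  · intro h
    exact ⟨_, h, rfl⟩

/-- The map on cosets. -/
def fC (y1 y2 : Y) (C : Set X) : Set X := {b | ∃ a ∈ C, K.Rx y1 y2 a b}

theorem fC_coset (y1 y2 : Y) (a : X) : K.fC y1 y2 (coset (K.TN y1 y2) a) = {b | K.Rx y1 y2 a b} := by
  ext b
  constructor
  · rintro ⟨a', h, h'⟩
    obtain ⟨d, h1, h2⟩ := K.mem_coset_TN.1 h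
    exact K.X2 h2 h1 h'
  · intro h
    exact ⟨a, K.mem_coset_TN.2 ⟨b, h, h⟩, h⟩

theorem coset_UN {y1 y2 : Y} {a b : X} (h : K.Rx y1 y2 a b) :
    coset (K.TN y2 y1) b = {b | K.Rx y1 y2 a b} := by
  ext b'
  rw [K.mem_coset_TN]
  constructor
  · rintro ⟨d, h1, h2⟩
    exact K.X2 (K.Rx_symm h1) h (K.Rx_symm h2)
  · intro h'
    exact ⟨a, K.Rx_symm h, K.Rx_symm h'⟩

theorem fC_eq {y1 y2 : Y} {a b : X} (h : K.Rx y1 y2 a b) :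
    K.fC y1 y2 (coset (K.TN y1 y2) a) = coset (K.TN y2 y1) b := by
  rw [K.fC_coset, K.coset_UN h]

theorem self_mem_coset (y1 y2 : Y) (a : X) : a ∈ coset (K.TN y1 y2) a := by
  obtain ⟨b, hb⟩ := K.X1 y1 y2 a
  exact K.mem_coset_TN.2 ⟨b, hb, hb⟩

theorem coset_eq {y1 y2 : Y} {a a' : X} (h : a' ∈ coset (K.TN y1 y2) a) :
    coset (K.TN y1 y2) a' = coset (K.TN y1 y2) a := by
  obtain ⟨b, h1, h2⟩ := K.mem_coset_TN.1 h
  rw [K.coset_UN (K.Rx_symm h1), K.coset_UN (K.Rx_symm h2)]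

theorem Rx_of_fC {y1 y2 : Y} {a b : X}
    (h : K.fC y1 y2 (coset (K.TN y1 y2) a) = coset (K.TN y2 y1) b) : K.Rx y1 y2 a b := by
  have := K.self_mem_coset y2 y1 b
  rw [← h, K.fC_coset] at this
  exact this

/-- Membership in the quotient relation, through representatives. -/
theorem mem_quotRel {y1 y2 : Y} {s : Set (X × X)} {w : Set X × Set X} :
    w ∈ quotRel (K.TN y1 y2) s ↔
      ∃ p ∈ s, w = (coset (K.TN y1 y2) p.1, coset (K.TN y1 y2) p.2) := by
  constructor
  · rintro ⟨x1, x2, rfl, p, hp, h1, h2⟩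
    exact ⟨p, hp, by rw [K.coset_eq h1, K.coset_eq h2]⟩
  · rintro ⟨p, hp, rfl⟩
    exact ⟨_, _, rfl, p, hp, K.self_mem_coset _ _ _, K.self_mem_coset _ _ _⟩

theorem elemMapsTo_iff {y1 y2 : Y} {r r' : Set (X × X)} :
    elemMapsTo (K.fC y1 y2) (quotRel (K.TN y1 y2) r) (quotRel (K.TN y2 y1) r') ↔
      ∀ w ∈ r, ∃ v ∈ r', K.Rx y1 y2 w.1 v.1 ∧ K.Rx y1 y2 w.2 v.2 := by
  constructor
  · intro h w hw
    have := h _ (K.mem_quotRel.2 ⟨w, hw, rfl⟩)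
    obtain ⟨v, hv, hv'⟩ := K.mem_quotRel.1 this
    simp only [Prod.mk.injEq] at hv'
    exact ⟨v, hv, K.Rx_of_fC hv'.1, K.Rx_of_fC hv'.2⟩
  · intro h W hW
    obtain ⟨w, hw, rfl⟩ := K.mem_quotRel.1 hW
    obtain ⟨v, hv, h1, h2⟩ := h w hw
    refine K.mem_quotRel.2 ⟨v, hv, ?_⟩
    simp only [K.fC_eq h1, K.fC_eq h2]

theorem elemMapsTo_clsk {y1 y2 : Y} {a a' : X} {k' : L} :
    elemMapsTo (K.fC y1 y2) (quotRel (K.TN y1 y2) (clsk (K.c y1) (K.c y1 a a')))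
      (quotRel (K.TN y2 y1) (clsk (K.c y2) k')) ↔ K.CR y1 y2 (K.c y1 a a') k' := by
  rw [K.elemMapsTo_iff, K.CR_iff]
  constructor
  · intro h
    obtain ⟨v, hv, h1, h2⟩ := h (a, a') rfl
    exact ⟨a, a', v.1, v.2, h1, h2, rfl, hv⟩
  · rintro ⟨p, p', q, q', h1, h2, h3, h4⟩ w hw
    obtain ⟨d, hd⟩ := K.X1 y1 y2 w.1
    obtain ⟨d', q1, q2⟩ := K.X4 h1 h2 (h3.trans hw.symm) hd
    exact ⟨(d, d'), q2.trans h4, hd, q1⟩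

theorem quot_sub {y1 y2 : Y} {r1 r2 r' : Set (X × X)} (h1 : r1 ∈ relsOf (K.c y1))
    (h2 : r2 ∈ relsOf (K.c y1)) (hr' : r' ∈ relsOf (K.c y2))
    (m1 : elemMapsTo (K.fC y1 y2) (quotRel (K.TN y1 y2) r1) (quotRel (K.TN y2 y1) r'))
    (m2 : elemMapsTo (K.fC y1 y2) (quotRel (K.TN y1 y2) r2) (quotRel (K.TN y2 y1) r')) :
    quotRel (K.TN y1 y2) r2 ⊆ quotRel (K.TN y1 y2) r1 := by
  intro W hW
  obtain ⟨w, hw, rfl⟩ := K.mem_quotRel.1 hW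
  rw [K.elemMapsTo_iff] at m1 m2
  obtain ⟨a, a', rfl⟩ := h1
  obtain ⟨b, b', rfl⟩ := hr'
  obtain ⟨v1, hv1, p1, p2⟩ := m1 (a, a') rfl
  obtain ⟨v2, hv2, q1, q2⟩ := m2 w hw
  obtain ⟨d, hd, hd'⟩ := K.X4 (K.Rx_symm p1) (K.Rx_symm p2) (hv1.trans hv2.symm) (K.Rx_symm q1)
  refine K.mem_quotRel.2 ⟨(w.1, d), hd', ?_⟩
  simp only [Prod.mk.injEq, true_and]
  exact (K.coset_eq (K.mem_coset_TN.2 ⟨_, q2, K.Rx_symm hd⟩)).symm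

theorem iso (y1 y2 : Y) :
    IsBasedIsoOn (quotPres (relsOf (K.c y1)) (K.TN y1 y2) K.x0)
      (quotPres (relsOf (K.c y2)) (K.TN y2 y1) K.x0) (K.fC y1 y2) := by
  have hmaps : Set.MapsTo (K.fC y1 y2) (cosets (K.TN y1 y2)) (cosets (K.TN y2 y1)) := by
    rintro C ⟨a, rfl⟩
    obtain ⟨b, hb⟩ := K.X1 y1 y2 a
    exact ⟨b, K.fC_eq hb⟩
  refine ⟨⟨⟨hmaps, ?_⟩, ⟨hmaps, ?_, ?_⟩, ?_⟩, K.fC_eq (K.Rx_base _ _)⟩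
  · rintro s ⟨r, ⟨a, a', rfl⟩, rfl⟩ w hw w' hw'
    obtain ⟨b, hb⟩ := K.X1 y1 y2 a
    obtain ⟨b', hb'⟩ := K.X1 y1 y2 a'
    have hm : elemMapsTo (K.fC y1 y2) (quotRel (K.TN y1 y2) (clsk (K.c y1) (K.c y1 a a')))
      (quotRel (K.TN y2 y1) (clsk (K.c y2) (K.c y2 b b'))) :=
      K.elemMapsTo_clsk.2 (K.CR_iff.2 ⟨a, a', b, b', hb, hb', rfl, rfl⟩)
    exact ⟨_, ⟨_, ⟨b, b', rfl⟩, rfl⟩, hm w hw, hm w' hw'⟩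
  · rintro C ⟨a, rfl⟩ C' ⟨a', rfl⟩ h
    obtain ⟨b, hb⟩ := K.X1 y1 y2 a
    rw [K.fC_eq hb] at h
    have := K.Rx_of_fC h.symm
    exact (K.coset_eq (K.mem_coset_TN.2 ⟨b, hb, this⟩)).symm
  · rintro C ⟨b, rfl⟩
    obtain ⟨a, ha⟩ := K.X1 y2 y1 b
    exact ⟨_, ⟨a, rfl⟩, K.fC_eq (K.Rx_symm ha)⟩
  · rintro t ⟨r, hr, rfl⟩
    have hr0 := hr
    obtain ⟨b, b', rfl⟩ := hr
    obtain ⟨a, ha⟩ := K.X1 y2 y1 b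
    obtain ⟨a', ha'⟩ := K.X1 y2 y1 b'
    have hm : elemMapsTo (K.fC y1 y2) (quotRel (K.TN y1 y2) (clsk (K.c y1) (K.c y1 a a')))
      (quotRel (K.TN y2 y1) (clsk (K.c y2) (K.c y2 b b'))) :=
      K.elemMapsTo_clsk.2 (K.CR_iff.2 ⟨a, a', b, b', K.Rx_symm ha, K.Rx_symm ha', rfl, rfl⟩)
    refine ⟨_, ⟨⟨_, ⟨a, a', rfl⟩, rfl⟩, hm⟩, ?_⟩
    rintro s ⟨⟨r, hr, rfl⟩, hs⟩
    exact Set.Subset.antisymm (K.quot_sub ⟨a, a', rfl⟩ hr hr0 hm hs)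
      (K.quot_sub hr ⟨a, a', rfl⟩ hr0 hs hm)

theorem TN_closed (y1 y2 : Y) : IsClosedIn (relsOf (K.c y1)) (K.TN y1 y2) := by
  refine ⟨fun r hr => hr.1, ?_⟩
  rintro p hp q hq r ⟨hr, hpos⟩
  obtain ⟨w, hw, z, h1, h2⟩ := aC_pos hpos
  rw [mem_transp] at h1
  have m1 : w.1 ∈ coset (K.TN y1 y2) z := ⟨p, hp, h1⟩
  have m2 : w.2 ∈ coset (K.TN y1 y2) z := ⟨q, hq, h2⟩
  rw [← K.coset_eq m1] at m2
  exact ⟨hr, w, hw, K.mem_coset_TN.1 m2⟩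

theorem TN_normal [Finite X] (y1 y2 : Y) : IsNormalIn (relsOf (K.c y1)) (K.TN y1 y2) := by
  rintro p ⟨p1, p2, rfl⟩
  have hp : clsk (K.c y1) (K.c y1 p1 p2) ∈ relsOf (K.c y1) := ⟨_, _, rfl⟩
  ext r
  simp only [setMulS, Set.mem_iUnion, Set.mem_singleton_iff, exists_prop, exists_eq_left]
  constructor
  · rintro ⟨q, hq, hr⟩
    rw [mem_cmulS (K.c_isScheme y1) hp hq.1] at hr
    obtain ⟨hr, ⟨a, c⟩, hw, b, h1, h2⟩ := hr
    have m : c ∈ coset (K.TN y1 y2) b := ⟨q, hq, h2⟩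
    obtain ⟨d2, e1, e2⟩ := K.mem_coset_TN.1 m
    obtain ⟨d, hd⟩ := K.X1 y1 y2 a
    obtain ⟨b', s1, s2⟩ := K.X4 (K.Rx_symm e1) (K.Rx_symm hd) rfl (K.Rx_symm e2)
    have ht : clsk (K.c y1) (K.c y1 a b') ∈ K.TN y1 y2 :=
      K.clsk_mem_TN.2 ⟨d, hd, K.Rx_symm s1⟩
    refine ⟨_, ht, ?_⟩
    rw [mem_cmulS (K.c_isScheme y1) ht.1 hp]
    exact ⟨hr, _, hw, b', rfl, (K.c_symm s2).trans h1⟩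
  · rintro ⟨q, hq, hr⟩
    rw [mem_cmulS (K.c_isScheme y1) hq.1 hp] at hr
    obtain ⟨hr, ⟨a, c⟩, hw, b, h1, h2⟩ := hr
    have m : b ∈ coset (K.TN y1 y2) a := ⟨q, hq, h1⟩
    obtain ⟨d, e1, e2⟩ := K.mem_coset_TN.1 m
    obtain ⟨d2, hd⟩ := K.X1 y1 y2 c
    obtain ⟨b', s1, s2⟩ := K.X4 (K.Rx_symm e2) (K.Rx_symm hd) rfl (K.Rx_symm e1)
    have ht : clsk (K.c y1) (K.c y1 b' c) ∈ K.TN y1 y2 :=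
      K.clsk_mem_TN.2 ⟨d2, K.Rx_symm s1, hd⟩
    refine ⟨_, ht, ?_⟩
    rw [mem_cmulS (K.c_isScheme y1) hp ht.1]
    exact ⟨hr, _, hw, b', s2.trans h2, rfl⟩

end Ctx

/-! ### The action -/

namespace Ctx

section Act

variable {T U : BScheme} {Z L M : Type} (K : Ctx Z U.X T.X L M)

/-- The labelling of the block scheme of `y`. -/
def al (y : U.X) (p : Set (T.X × T.X)) : Set (T.X × T.X) :=
  {w | (y = U.base ∧ w ∈ p) ∨ (y ≠ U.base ∧ ∃ v ∈ p, K.c U.base v.1 v.2 = K.c y w.1 w.2)}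

theorem al_base (p : Set (T.X × T.X)) : K.al U.base p = p := by
  ext w
  simp [al]

theorem al_clsk (y : U.X) (p1 p2 : T.X) :
    K.al y (clsk (K.c U.base) (K.c U.base p1 p2)) = clsk (K.c y) (K.c U.base p1 p2) := by
  by_cases h : y = U.base
  · subst h
    exact K.al_base _
  · ext w
    simp only [al, h, ne_eq, not_false_eq_true, true_and, false_and, false_or, Set.mem_ofPred_eq,
      clsk]
    constructor
    · rintro ⟨v, hv, hv'⟩
      exact hv'.symm.trans hv
    · intro hw
      exact ⟨(p1, p2), rfl, hw.symm⟩

theorem al_out {y : U.X} {p : Set (T.X × T.X)} {w : T.X × T.X} (h : w ∈ K.al y p) :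
    ∃ v ∈ p, K.c U.base v.1 v.2 = K.c y w.1 w.2 := by
  rcases h with ⟨rfl, h⟩ | ⟨_, h⟩
  · exact ⟨w, h, rfl⟩
  · exact h

theorem al_in (y : U.X) {p : Set (T.X × T.X)} {v : T.X × T.X} (h : v ∈ p) :
    ∃ w ∈ K.al y p, K.c U.base v.1 v.2 = K.c y w.1 w.2 := by
  by_cases hy : y = U.base
  · subst hy
    exact ⟨v, Or.inl ⟨rfl, h⟩, rfl⟩
  · obtain ⟨b, hb⟩ := K.c_row (y := U.base) y v.1 v.2 v.1
    exact ⟨(v.1, b), Or.inr ⟨hy, v, h, hb.symm⟩, hb.symm⟩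

theorem al_maps {y1 y2 : U.X} {t : Set (T.X × T.X)} {q1 q2 : T.X} :
    elemMapsTo (K.fC y1 y2) (quotRel (K.TN y1 y2) (K.al y1 t))
      (quotRel (K.TN y2 y1) (K.al y2 (clsk (K.c U.base) (K.c U.base q1 q2)))) ↔
    ∀ v ∈ t, K.CR y1 y2 (K.c U.base v.1 v.2) (K.c U.base q1 q2) := by
  rw [K.al_clsk, K.elemMapsTo_iff]
  constructor
  · intro h v hv
    obtain ⟨w, hw, he⟩ := K.al_in y1 hv
    obtain ⟨x, hx, h1, h2⟩ := h w hw
    exact K.CR_iff.2 ⟨w.1, w.2, x.1, x.2, h1, h2, he.symm, hx⟩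
  · intro h w hw
    obtain ⟨v, hv, he⟩ := K.al_out hw
    have := h v hv
    rw [he, ← K.elemMapsTo_clsk, K.elemMapsTo_iff] at this
    exact this w rfl

/-- The `τ`-scheme attached to `y`. -/
def tau (hT : T.S = relsOf (K.c U.base)) (y : U.X) : TauSchemeOn T where
  rels := relsOf (K.c y)
  isScheme := K.c_isScheme y
  alpha := K.al y
  alpha_bij := by
    rw [hT]
    refine ⟨?_, ?_, ?_⟩
    · rintro p ⟨a, b, rfl⟩
      obtain ⟨d, hd⟩ := K.c_row (y := U.base) y a b a
      rw [K.al_clsk, ← hd]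
      exact ⟨_, _, rfl⟩
    · rintro p ⟨a, b, rfl⟩ p' ⟨a', b', rfl⟩ h
      rw [K.al_clsk, K.al_clsk] at h
      obtain ⟨d, hd⟩ := K.c_row (y := U.base) y a b a
      have : (a, d) ∈ clsk (K.c y) (K.c U.base a b) := hd
      rw [h] at this
      have h2 : K.c y a d = K.c U.base a' b' := this
      rw [← hd, h2]
    · rintro p ⟨a, b, rfl⟩
      obtain ⟨d, hd⟩ := K.c_row (y := y) U.base a b a
      refine ⟨_, ⟨a, d, rfl⟩, ?_⟩
      rw [K.al_clsk, hd]
  alpha_one := by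
    rw [K.diag_eq U.base U.base T.base, K.al_clsk, ← K.diag_eq, K.diag_eq U.base U.base T.base]
  alpha_star := by
    rw [hT]
    rintro p ⟨a, b, rfl⟩
    have h : transp (clsk (K.c U.base) (K.c U.base a b)) = clsk (K.c U.base) (K.c U.base b a) := by
      ext ⟨x, y⟩
      rw [mem_transp]
      exact ⟨K.c_symm, K.c_symm⟩
    rw [h, K.al_clsk, K.al_clsk]
    ext ⟨x, y⟩
    rw [mem_transp]
    exact ⟨K.c_symm, K.c_symm⟩
  alpha_const := by
    rw [hT]
    rintro p ⟨p1, p2, rfl⟩ q ⟨q1, q2, rfl⟩ r ⟨r1, r2, rfl⟩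
    obtain ⟨d, hd⟩ := K.c_row (y := U.base) y r1 r2 r1
    rw [K.al_clsk, K.al_clsk, K.al_clsk, aC_clsk _ (fun h => K.c_count h), ← hd,
      aC_clsk _ (fun h => K.c_count h)]
    exact K.c_count hd.symm _ _

/-- The morphisms of the action. -/
def homC (hx : K.x0 = T.base) (hT : T.S = relsOf (K.c U.base)) (y1 y2 : U.X) :
    HomC (K.tau hT y1).toB (K.tau hT y2).toB where
  TN := K.TN y1 y2
  UN := K.TN y2 y1
  TN_cl := K.TN_closed y1 y2
  TN_n := haveI := T.fin; K.TN_normal y1 y2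
  UN_cl := K.TN_closed y2 y1
  UN_n := haveI := T.fin; K.TN_normal y2 y1
  f := K.fC y1 y2
  iso := by
    have := K.iso y1 y2
    rw [hx] at this
    exact this

theorem TN_refl (y : U.X) : K.TN y y = {diagRel T.X} := by
  ext r
  rw [Set.mem_singleton_iff]
  constructor
  · rintro ⟨⟨a, b, rfl⟩, ⟨p, q⟩, hw, d, h1, h2⟩
    rw [K.Rx_self] at h1 h2
    have h : p = q := h1.trans h2.symm
    subst h
    have hw : K.c y p p = K.c y a b := hw
    rw [← hw]
    exact (K.diag_eq y y p).symm
  · rintro rfl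
    rw [K.diag_eq y y T.base, K.clsk_mem_TN]
    exact ⟨_, (K.Rx_self _ _ _).2 rfl, (K.Rx_self _ _ _).2 rfl⟩

theorem mem_Vcomp (hx : K.x0 = T.base) (hT : T.S = relsOf (K.c U.base)) {y1 y2 y3 : U.X}
    {o : U.X} {x a b : T.X} (h : K.V y1 y2 y3 (K.e o x) (K.c y3 a b)) :
    clsk (K.c y3) (K.c y3 a b) ∈ Vcomp (K.homC hx hT y1 y2) (K.homC hx hT y2 y3) := by
  obtain ⟨k, h1, h2⟩ := h
  obtain ⟨p, p', q, q', _, _, _, rfl⟩ := K.CR_iff.1 h1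
  refine ⟨⟨a, b, rfl⟩, _, ⟨q, q', rfl⟩, ?_, ?_⟩
  · change elemMapsTo (K.fC y1 y2) (quotRel (K.TN y1 y2) (diagRel T.X)) (quotRel (K.TN y2 y1) _)
    rw [K.diag_eq y1 y1 x, K.elemMapsTo_clsk, K.c_refl y1 o x x]
    exact h1
  · exact K.elemMapsTo_clsk.2 h2

theorem mem_Tcomp (hx : K.x0 = T.base) (hT : T.S = relsOf (K.c U.base)) {y1 y2 y3 : U.X}
    {o : U.X} {x a b : T.X} {k : L} (h1 : K.CR y1 y2 (K.c y1 a b) k)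
    (h2 : K.CR y2 y3 k (K.c o x x)) :
    clsk (K.c y1) (K.c y1 a b) ∈ Tcomp (K.homC hx hT y1 y2) (K.homC hx hT y2 y3) := by
  obtain ⟨p, p', q, q', _, _, _, rfl⟩ := K.CR_iff.1 h1
  refine ⟨⟨a, b, rfl⟩, _, ⟨q, q', rfl⟩, K.elemMapsTo_clsk.2 h1, ?_⟩
  change elemMapsTo (K.fC y2 y3) (quotRel (K.TN y2 y3) _) (quotRel (K.TN y3 y2) (diagRel T.X))
  rw [K.diag_eq y3 o x]
  exact K.elemMapsTo_clsk.2 h2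

/-- The action. -/
def action (hx : K.x0 = T.base) (hT : T.S = relsOf (K.c U.base))
    (hU : ∀ u ∈ U.S, ∀ y1 y2 y1' y2', (y1, y2) ∈ u → (y1', y2') ∈ u →
      K.uc y1 y2 = K.uc y1' y2') : SchemeAction U T where
  Z := K.tau hT
  hom := K.homC hx hT
  base_rels := hT.symm
  base_alpha := K.al_base
  hom_refl_TN := K.TN_refl
  hom_refl_UN := K.TN_refl
  hom_refl_f y x := by
    rw [← K.TN_refl y]
    exact K.fC_eq ((K.Rx_self _ _ _).2 rfl)
  hom_symm_TN _ _ := rfl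
  hom_symm_UN _ _ := rfl
  hom_symm_f y1 y2 := by
    constructor
    · rintro C ⟨a, rfl⟩
      obtain ⟨b, hb⟩ := K.X1 y1 y2 a
      change K.fC y2 y1 (K.fC y1 y2 (coset (K.TN y1 y2) a)) = coset (K.TN y1 y2) a
      rw [K.fC_eq hb, K.fC_eq (K.Rx_symm hb)]
    · rintro C ⟨a, rfl⟩
      obtain ⟨b, hb⟩ := K.X1 y2 y1 a
      change K.fC y1 y2 (K.fC y2 y1 (coset (K.TN y2 y1) a)) = coset (K.TN y2 y1) a
      rw [K.fC_eq hb, K.fC_eq (K.Rx_symm hb)]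
  zeta_welldef u hu y1 y2 y1' y2' h h' Pp := by
    have hh := hU u hu _ _ _ _ h h'
    ext q
    constructor
    · rintro ⟨hq, t, ht, hm⟩
      refine ⟨hq, t, ht, ?_⟩
      rw [hT] at hq
      obtain ⟨q1, q2, rfl⟩ := hq
      exact K.al_maps.2 fun v hv => K.CR_uc hh (K.al_maps.1 hm v hv)
    · rintro ⟨hq, t, ht, hm⟩
      refine ⟨hq, t, ht, ?_⟩
      rw [hT] at hq
      obtain ⟨q1, q2, rfl⟩ := hq
      exact K.al_maps.2 fun v hv => K.CR_uc hh.symm (K.al_maps.1 hm v hv)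
  le_comp y1 y2 y3 := by
    refine ⟨?_, ?_, ?_⟩
    · intro r hr
      have hr : r ∈ K.TN y1 y3 := hr
      have hr0 := hr
      obtain ⟨⟨a, b, rfl⟩, _⟩ := hr
      obtain ⟨d, h1, h2⟩ := K.clsk_mem_TN.1 hr0
      obtain ⟨k, q1, q2⟩ := K.K5a (y2 := y2) (K.bl_e _ _) (K.bl_e _ _) (K.bl_e _ _) h1 h2
        (K.e y1 a)
      exact K.mem_Tcomp hx hT q1 q2
    · intro r hr
      have hr : r ∈ K.TN y3 y1 := hr
      have hr0 := hr
      obtain ⟨⟨a, b, rfl⟩, _⟩ := hr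
      obtain ⟨d, h1, h2⟩ := K.clsk_mem_TN.1 hr0
      exact K.mem_Vcomp hx hT (K.V_of (K.bl_e _ _) (K.bl_e _ _) (K.bl_e _ _) (K.R_symm h1)
        (K.R_symm h2) (K.e y1 a))
    · intro x x2 x3 h1 h2 x3' h3
      have h1 := K.Rx_of_fC h1
      have h2 := K.Rx_of_fC h2
      have h3 : x3' ∈ K.fC y1 y3 (coset (K.TN y1 y3) x) := h3
      rw [K.fC_coset] at h3
      exact ⟨_, K.mem_Vcomp hx hT (K.K5c (K.bl_e _ _) (K.bl_e _ _) (K.bl_e _ _) (K.bl_e _ _)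
        h1 h2 h3 (K.e y1 x)), rfl⟩

theorem rel_iff (hx : K.x0 = T.base) (hT : T.S = relsOf (K.c U.base))
    (hU : ∀ u ∈ U.S, ∀ y1 y2 y1' y2', (y1, y2) ∈ u → (y1', y2') ∈ u →
      K.uc y1 y2 = K.uc y1' y2') (u : Set (U.X × U.X)) (p1 p2 : T.X) (z1 z2 : Z) :
    ((K.bl z1, K.ei z1), (K.bl z2, K.ei z2)) ∈
      (K.action hx hT hU).rel u (clsk (K.c U.base) (K.c U.base p1 p2)) ↔
    (K.bl z1, K.bl z2) ∈ u ∧ ∃ d, K.bl d = K.bl z2 ∧ K.R z1 d ∧ K.col d z2 = K.c U.base p1 p2 := by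
  change ((K.bl z1, K.bl z2) ∈ u ∧ (K.fC (K.bl z1) (K.bl z2) (coset (K.TN (K.bl z1) (K.bl z2))
    (K.ei z1)), coset (K.TN (K.bl z2) (K.bl z1)) (K.ei z2)) ∈
    quotRel (K.TN (K.bl z2) (K.bl z1))
      (K.al (K.bl z2) (clsk (K.c U.base) (K.c U.base p1 p2)))) ↔ _
  rw [K.al_clsk, K.mem_quotRel]
  refine and_congr_right fun _ => ?_
  constructor
  · rintro ⟨⟨q1, q2⟩, hw, he⟩
    simp only [Prod.mk.injEq] at he
    have h1 := K.Rx_of_fC he.1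
    have h2 : q2 ∈ coset (K.TN (K.bl z2) (K.bl z1)) (K.ei z2) := by
      rw [he.2]
      exact K.self_mem_coset _ _ _
    obtain ⟨a', r1, r2⟩ := K.mem_coset_TN.1 h2
    obtain ⟨d, s1, s2⟩ := K.X4 (K.Rx_symm r2) h1 rfl (K.Rx_symm r1)
    refine ⟨K.e (K.bl z2) d, K.bl_e _ _, ?_, ?_⟩
    · unfold Rx at s1
      rwa [K.e_ei] at s1
    · have s3 := (K.c_symm s2).trans hw
      unfold c at s3
      rw [K.e_ei] at s3
      exact s3
  · rintro ⟨d, hd, hR, hc⟩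
    obtain ⟨d, rfl⟩ := K.ex_e hd
    refine ⟨(d, K.ei z2), ?_, ?_⟩
    · change K.col _ _ = _
      rw [K.e_ei]
      exact hc
    · simp only [Prod.mk.injEq, and_true]
      apply K.fC_eq
      unfold Rx
      rw [K.e_ei]
      exact hR

theorem sdp_iso (hx : K.x0 = T.base) (hT : T.S = relsOf (K.c U.base))
    (hU : ∀ u ∈ U.S, ∀ y1 y2 y1' y2', (y1, y2) ∈ u → (y1', y2') ∈ u →
      K.uc y1 y2 = K.uc y1' y2')
    (hU1 : ∀ u ∈ U.S, ∀ y1 y2 y1' y2', (y1, y2) ∈ u → K.uc y1 y2 = K.uc y1' y2' →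
      (y1', y2') ∈ u) :
    IsBasedIsoOn (fullPres (relsOf K.col) (K.i U.base))
      (fullPres (K.action hx hT hU).sdp (U.base, T.base)) (fun z => (K.bl z, K.ei z)) := by
  have key : ∀ u ∈ U.S, ∀ p1 p2 z1 z2 z1' z2', K.col z1 z2 = K.col z1' z2' →
      ((K.bl z1, K.ei z1), (K.bl z2, K.ei z2)) ∈
        (K.action hx hT hU).rel u (clsk (K.c U.base) (K.c U.base p1 p2)) →
      ((K.bl z1', K.ei z1'), (K.bl z2', K.ei z2')) ∈
        (K.action hx hT hU).rel u (clsk (K.c U.base) (K.c U.base p1 p2)) := by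
    intro u hu p1 p2 z1 z2 z1' z2' hc h
    rw [rel_iff] at h ⊢
    obtain ⟨h1, d, hd, hR, hdc⟩ := h
    refine ⟨hU1 u hu _ _ _ _ h1 (K.uc_col hc), ?_⟩
    obtain ⟨d', q1, q2⟩ := K.transfer hc d
    exact ⟨d', K.bl_col q2.symm hd, K.R_of hR q1, q2.trans hdc⟩
  have key2 : ∀ u ∈ U.S, ∀ p1 p2 z1 z2 z1' z2',
      ((K.bl z1, K.ei z1), (K.bl z2, K.ei z2)) ∈
        (K.action hx hT hU).rel u (clsk (K.c U.base) (K.c U.base p1 p2)) →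
      ((K.bl z1', K.ei z1'), (K.bl z2', K.ei z2')) ∈
        (K.action hx hT hU).rel u (clsk (K.c U.base) (K.c U.base p1 p2)) →
      K.col z1 z2 = K.col z1' z2' := by
    intro u hu p1 p2 z1 z2 z1' z2' h h'
    rw [rel_iff] at h h'
    obtain ⟨h1, d, hd, hR, hdc⟩ := h
    obtain ⟨h1', d', hd', hR', hdc'⟩ := h'
    have huc := hU u hu _ _ _ _ h1 h1'
    exact K.col_symm (K.star' hd.symm hd'.symm (K.col_symm (hdc.trans hdc'.symm)) (K.R_symm hR)
      (K.R_symm hR') (by rw [hd, hd']; exact K.uc_symm huc))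
  have hbase : (K.bl (K.i U.base), K.ei (K.i U.base)) = (U.base, T.base) := by
    rw [K.bl_i, ← K.e_base, K.ei_e, hx]
  refine ⟨⟨⟨fun _ _ => trivial, ?_⟩, ⟨fun _ _ => trivial, ?_, ?_⟩, ?_⟩, hbase⟩
  · rintro s ⟨z1, z2, rfl⟩ ⟨a, b⟩ hw ⟨a', b'⟩ hw'
    have hw : K.col a b = K.col z1 z2 := hw
    have hw' : K.col a' b' = K.col z1 z2 := hw'
    obtain ⟨u, ⟨hu, hmem⟩, _⟩ := U.isScheme.2.1 (K.bl a, K.bl b)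
    obtain ⟨d, hd, hR⟩ := K.L1 a (K.bl b)
    obtain ⟨d1, hd1⟩ := K.ex_e hd
    obtain ⟨p2, hp⟩ := K.c_row (y := K.bl b) U.base d1 (K.ei b) d1
    have hp' : K.c U.base d1 p2 = K.col d b := by
      rw [hp, c, hd1, K.e_ei]
    have hab : ((K.bl a, K.ei a), (K.bl b, K.ei b)) ∈
        (K.action hx hT hU).rel u (clsk (K.c U.base) (K.c U.base d1 p2)) := by
      rw [rel_iff]
      exact ⟨hmem, d, hd, hR, hp'.symm⟩
    refine ⟨_, ⟨u, hu, clsk (K.c U.base) (K.c U.base d1 p2), ?_, rfl⟩, hab,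
      key u hu _ _ _ _ _ _ (hw.trans hw'.symm) hab⟩
    rw [hT]
    exact ⟨_, _, rfl⟩
  · intro a _ b _ h
    simp only [Prod.mk.injEq] at h
    rw [← K.e_ei a, ← K.e_ei b, h.1, h.2]
  · rintro ⟨y, x⟩ _
    exact ⟨K.e y x, trivial, by simp [K.bl_e, K.ei_e]⟩
  · rintro r ⟨u, hu, t, ht, rfl⟩
    rw [hT] at ht
    obtain ⟨p1, p2, rfl⟩ := ht
    obtain ⟨⟨y1, y2⟩, hy⟩ := U.isScheme.1 u hu
    obtain ⟨z, hz⟩ := K.row (a := K.e U.base p1) (a' := K.i y2) (K.e U.base p2)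
    have hzb : K.bl z = y2 := by
      have := K.bl_col hz.symm (by simp [K.bl_e])
      rw [← this, K.bl_i]
    have h0 : ((K.bl (K.i y1), K.ei (K.i y1)), (K.bl z, K.ei z)) ∈
        (K.action hx hT hU).rel u (clsk (K.c U.base) (K.c U.base p1 p2)) := by
      rw [rel_iff, hzb, K.bl_i]
      exact ⟨hy, K.i y2, K.bl_i _, K.R_i _ _, hz⟩
    refine ⟨_, ⟨⟨K.i y1, z, rfl⟩, ?_⟩, ?_⟩
    · rintro ⟨a, b⟩ hw
      exact key u hu _ _ _ _ _ _ (Eq.symm hw) h0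
    · rintro s ⟨⟨a, b, rfl⟩, hs⟩
      have := key2 u hu _ _ _ _ _ _ (hs (a, b) rfl) h0
      rw [this]

end Act

end Ctx

/-! ### The colouring of a scheme -/

/-- The element of a scheme containing a pair of points. -/
noncomputable def schCol {X : Type} {S : Set (Set (X × X))} (hS : IsScheme S) (a b : X) :
    Set (X × X) := Classical.choose (hS.2.1 (a, b)).exists

section SchCol

variable {X : Type} {S : Set (Set (X × X))} (hS : IsScheme S)

theorem schCol_mem (a b : X) : schCol hS a b ∈ S :=
  (Classical.choose_spec (hS.2.1 (a, b)).exists).1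

theorem mem_schCol (a b : X) : (a, b) ∈ schCol hS a b :=
  (Classical.choose_spec (hS.2.1 (a, b)).exists).2

theorem schCol_eq {a b : X} {s : Set (X × X)} (hs : s ∈ S) : schCol hS a b = s ↔ (a, b) ∈ s := by
  constructor
  · rintro rfl
    exact mem_schCol hS a b
  · intro h
    exact (hS.2.1 (a, b)).unique ⟨schCol_mem hS a b, mem_schCol hS a b⟩ ⟨hs, h⟩

theorem relsOf_schCol : relsOf (schCol hS) = S := by
  have h : ∀ s ∈ S, clsk (schCol hS) s = s := by
    intro s hs
    ext ⟨a, b⟩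
    exact schCol_eq hS hs
  ext s
  constructor
  · rintro ⟨a, b, rfl⟩
    rw [h _ (schCol_mem hS a b)]
    exact schCol_mem hS a b
  · intro hs
    obtain ⟨⟨a, b⟩, hab⟩ := hS.1 s hs
    refine ⟨a, b, ?_⟩
    rw [(schCol_eq hS hs).2 hab, h s hs]

theorem schCol_diag {a b : X} : schCol hS a b = diagRel X ↔ a = b :=
  schCol_eq hS hS.2.2.1

theorem schCol_symm {a b a' b' : X} (h : schCol hS a b = schCol hS a' b') :
    schCol hS b a = schCol hS b' a' := by
  have h1 : ∀ a b, schCol hS b a = transp (schCol hS a b) := by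
    intro a b
    rw [schCol_eq hS (hS.2.2.2.1 _ (schCol_mem hS a b)), mem_transp]
    exact mem_schCol hS a b
  rw [h1 a b, h1 a' b', h]

theorem schCol_count {a b a' b' : X} (h : schCol hS a b = schCol hS a' b')
    (k l : Set (X × X)) :
    Nat.card {z // schCol hS a z = k ∧ schCol hS z b = l} =
      Nat.card {z // schCol hS a' z = k ∧ schCol hS z b' = l} := by
  by_cases hk : k ∈ S ∧ l ∈ S
  · obtain ⟨hk, hl⟩ := hk
    simp only [schCol_eq hS hk, schCol_eq hS hl]
    rw [hS.2.2.2.2 k hk l hl _ (schCol_mem hS a b) (a, b) (mem_schCol hS a b),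
      hS.2.2.2.2 k hk l hl _ (schCol_mem hS a b) (a', b') (by rw [h]; exact mem_schCol hS a' b')]
  · have h1 : ∀ p q, IsEmpty {z // schCol hS p z = k ∧ schCol hS z q = l} := by
      intro p q
      refine ⟨fun z => hk ⟨?_, ?_⟩⟩
      · rw [← z.2.1]
        exact schCol_mem hS _ _
      · rw [← z.2.2]
        exact schCol_mem hS _ _
    have := h1 a b
    have := h1 a' b'
    simp

theorem schCol_transfer [Finite X] {a b a' b' : X} (h : schCol hS a b = schCol hS a' b') (w : X) :
    ∃ w', schCol hS a' w' = schCol hS a w ∧ schCol hS w' b' = schCol hS w b := by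
  have h1 := schCol_count hS h (schCol hS a w) (schCol hS w b)
  have : Nonempty {z // schCol hS a z = schCol hS a w ∧ schCol hS z b = schCol hS w b} :=
    ⟨⟨w, rfl, rfl⟩⟩
  have h2 : 0 < Nat.card {z // schCol hS a z = schCol hS a w ∧ schCol hS z b = schCol hS w b} :=
    Nat.card_pos
  rw [h1] at h2
  obtain ⟨⟨z, hz⟩⟩ := (Nat.card_pos_iff.1 h2).1
  exact ⟨z, hz⟩

theorem schCol_equiv [Finite X] (a b : X) :
    ∃ F : X ≃ X, ∀ z, schCol hS b (F z) = schCol hS a z := by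
  have h1 : ∀ k, Nonempty ({z // schCol hS a z = k} ≃ {z // schCol hS b z = k}) := by
    intro k
    by_cases hk : ∃ p q, schCol hS p q = k
    · obtain ⟨p, q, rfl⟩ := hk
      have h2 : ∀ d, Nat.card {z // schCol hS d z = schCol hS p q} =
          Nat.card {z // schCol hS d z = schCol hS p q ∧ schCol hS z d = schCol hS q p} := by
        intro d
        refine Nat.card_congr (Equiv.subtypeEquivRight fun z => ?_)
        exact ⟨fun h => ⟨h, schCol_symm hS h⟩, fun h => h.1⟩
      have h3 := schCol_count hS (((schCol_diag hS).2 rfl).trans ((schCol_diag hS).2 rfl).symm :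
        schCol hS a a = schCol hS b b) (schCol hS p q) (schCol hS q p)
      rw [← h2, ← h2] at h3
      exact Finite.card_eq.1 h3
    · have h2 : ∀ d, IsEmpty {z // schCol hS d z = k} := fun d => ⟨fun z => hk ⟨_, _, z.2⟩⟩
      have := h2 a
      have := h2 b
      exact ⟨Equiv.equivOfIsEmpty _ _⟩
  let φ := fun k => Classical.choice (h1 k)
  refine ⟨((Equiv.sigmaFiberEquiv (schCol hS a)).symm.trans (Equiv.sigmaCongrRight φ)).trans
    (Equiv.sigmaFiberEquiv (schCol hS b)), fun z => ?_⟩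
  exact (φ _ ⟨z, rfl⟩).2

variable {Tt : Set (Set (X × X))}

theorem mem_coset_iff (hTt : IsClosedIn S Tt) {a b : X} :
    b ∈ coset Tt a ↔ schCol hS a b ∈ Tt := by
  constructor
  · rintro ⟨t, ht, h⟩
    rwa [(schCol_eq hS (hTt.1 ht)).2 h]
  · intro h
    exact ⟨_, h, mem_schCol hS a b⟩

theorem closed_trans [Finite X] (hTt : IsClosedIn S Tt) {a b c : X} (h1 : schCol hS a b ∈ Tt)
    (h2 : schCol hS a c ∈ Tt) : schCol hS b c ∈ Tt := by
  apply hTt.2 _ h1 _ h2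
  rw [mem_cmulS hS (hS.2.2.2.1 _ (hTt.1 h1)) (hTt.1 h2)]
  exact ⟨schCol_mem hS b c, (b, c), mem_schCol hS b c, a, mem_transp.2 (mem_schCol hS a b),
    mem_schCol hS a c⟩

theorem coset_eq_iff [Finite X] (hTt : IsClosedIn S Tt) (hne : Tt.Nonempty) {a b : X} :
    coset Tt a = coset Tt b ↔ schCol hS a b ∈ Tt := by
  have hrefl : ∀ a, schCol hS a a ∈ Tt := by
    obtain ⟨t, ht⟩ := hne
    obtain ⟨⟨p, q⟩, hpq⟩ := hS.1 t (hTt.1 ht)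
    rw [← (schCol_eq hS (hTt.1 ht)).2 hpq] at ht
    have h := closed_trans hS hTt ht ht
    intro a
    rwa [(schCol_diag hS).2 rfl] at h ⊢
  constructor
  · intro h
    rw [← mem_coset_iff hS hTt, h, mem_coset_iff hS hTt]
    exact hrefl b
  · intro h
    ext c
    rw [mem_coset_iff hS hTt, mem_coset_iff hS hTt]
    exact ⟨fun h' => closed_trans hS hTt h h',
      fun h' => closed_trans hS hTt (closed_trans hS hTt h (hrefl a)) h'⟩

theorem quotRel_sub [Finite X] {S : Set (Set (X × X))} (hS : IsScheme S) (hTt : IsClosedIn S Tt) (hne : Tt.Nonempty) {s s' : Set (X × X)}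
    (hs : s ∈ S) (hs' : s' ∈ S) {w : Set X × Set X} (h : w ∈ quotRel Tt s)
    (h' : w ∈ quotRel Tt s') : quotRel Tt s ⊆ quotRel Tt s' := by
  have hco := @coset_eq_iff X S hS Tt _ hTt hne
  obtain ⟨x1, x2, rfl, ⟨q1, q2⟩, hq, m1, m2⟩ := h
  obtain ⟨x1', x2', he, ⟨r1, r2⟩, hr, n1, n2⟩ := h'
  simp only [Prod.mk.injEq] at he
  rw [← he.1] at n1
  rw [← he.2] at n2
  simp only [mem_coset_iff hS hTt] at m1 m2 n1 n2
  rintro W ⟨y1, y2, rfl, ⟨p1, p2⟩, hp, k1, k2⟩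
  simp only [mem_coset_iff hS hTt] at k1 k2
  have e1 : schCol hS q1 q2 = schCol hS p1 p2 :=
    ((schCol_eq hS hs).2 hq).trans ((schCol_eq hS hs).2 hp).symm
  obtain ⟨w1, a1, a2⟩ := schCol_transfer hS e1 r1
  obtain ⟨w2, b1, b2⟩ := schCol_transfer hS a2.symm r2
  refine ⟨y1, y2, rfl, (w1, w2), ?_, ?_, ?_⟩
  · rw [← schCol_eq hS hs', b1, schCol_eq hS hs']
    exact hr
  · have c1 : schCol hS p1 w1 ∈ Tt := by
      rw [a1]
      exact closed_trans hS hTt m1 n1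
    rw [mem_coset_iff hS hTt, ← hco, hco.2 k1, hco]
    exact c1
  · have c1 : schCol hS w2 p2 ∈ Tt := by
      rw [b2]
      exact closed_trans hS hTt n2 m2
    rw [mem_coset_iff hS hTt, ← hco, hco.2 k2, eq_comm, hco]
    exact c1

end SchCol

theorem relsOf_congr {X L L' : Type} {c : X → X → L} {c' : X → X → L'}
    (h : ∀ a b a' b', c a b = c a' b' ↔ c' a b = c' a' b') : relsOf c = relsOf c' := by
  have h1 : ∀ a b, clsk c (c a b) = clsk c' (c' a b) := by
    intro a b
    ext w
    exact h _ _ _ _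
  unfold relsOf
  simp only [h1]

theorem stmt19
    (T U Sch : BScheme) (Tt : Set (Set (Sch.X × Sch.X)))
    (hTt : IsClosedIn Sch.S Tt)
    (hsub : ∃ g : Sch.X → T.X,
      IsBasedIsoOn (subPres Tt Sch.base) (fullPres T.S T.base) g)
    (i : U.X → Sch.X)
    (himor : IsMorOn (fullPres U.S U.base) (fullPres Sch.S Sch.base) i)
    (hibase : i U.base = Sch.base)
    (hipi : IsBasedIsoOn (fullPres U.S U.base) (quotPres Sch.S Tt Sch.base)
      (fun y => coset Tt (i y)))
    (iS : Set (U.X × U.X) → Set (Sch.X × Sch.X))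
    (hiS : ∀ u ∈ U.S, iS u ∈ Sch.S ∧ elemMapsTo i u (iS u))
    (hcond : ∀ u ∈ U.S, ∀ t ∈ Tt, ∃! s, s ∈ cmulS Sch.S t (iS u)) :
    ∃ act : SchemeAction U T, ∃ f : Sch.X → U.X × T.X,
      IsBasedIsoOn (fullPres Sch.S Sch.base)
        (fullPres act.sdp (U.base, T.base)) f := by
  have finS : Finite Sch.X := by
    have := Sch.fin
    exact Finite.of_fintype _
  have hS := Sch.isScheme
  have hTS := T.isScheme
  have hUS := U.isScheme
  obtain ⟨g, ⟨⟨gmap, gmor⟩, gbij, grel⟩, gbase⟩ := hsub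
  obtain ⟨⟨⟨pmap, pmor⟩, pbij, prel⟩, pbase⟩ := hipi
  have hne : Tt.Nonempty := by
    obtain ⟨z, ⟨t, ht, _⟩, _⟩ := gbij.2.2 (Set.mem_univ T.base)
    exact ⟨t, ht⟩
  have hco := @coset_eq_iff Sch.X Sch.S hS Tt _ hTt hne
  have hbl : ∀ z, ∃ y, coset Tt (i y) = coset Tt z := by
    intro z
    obtain ⟨y, _, hy⟩ := pbij.2.2 (show coset Tt z ∈ cosets Tt from ⟨z, rfl⟩)
    exact ⟨y, hy⟩
  choose bl hbl using hbl
  have iinj : ∀ y y', coset Tt (i y) = coset Tt (i y') → y = y' := fun y y' h =>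
    pbij.2.1 (Set.mem_univ y) (Set.mem_univ y') h
  have bl_i : ∀ y, bl (i y) = y := fun y => iinj _ _ (hbl (i y))
  have bl_iff : ∀ a b, bl a = bl b ↔ schCol hS a b ∈ Tt := by
    intro a b
    rw [← hco, ← hbl a, ← hbl b]
    exact ⟨fun h => by rw [h], fun h => iinj _ _ h⟩
  have uc_col : ∀ {a b a' b'}, schCol hS a b = schCol hS a' b' →
      schCol hUS (bl a) (bl b) = schCol hUS (bl a') (bl b') := by
    have hself : ∀ z, z ∈ coset Tt z := fun z => by
      rw [mem_coset_iff hS hTt, ← hco]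
    have hmap : ∀ a b, elemMapsTo (fun y => coset Tt (i y)) (schCol hUS (bl a) (bl b))
        (quotRel Tt (schCol hS a b)) := by
      intro a b w hw
      obtain ⟨t, ⟨s, hs, rfl⟩, h1, h2⟩ := pmor _ (schCol_mem hUS (bl a) (bl b)) (bl a, bl b)
        (mem_schCol hUS _ _) w hw
      refine quotRel_sub hS hTt hne hs (schCol_mem hS a b) h1 ?_ h2
      refine ⟨a, b, ?_, (a, b), mem_schCol hS a b, hself a, hself b⟩
      simp only [hbl]
    intro a b a' b' h
    have h1 := hmap a b
    have h2 := hmap a' b'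
    rw [← h] at h2
    exact (prel _ ⟨_, schCol_mem hS a b, rfl⟩).unique ⟨schCol_mem hUS _ _, h1⟩
      ⟨schCol_mem hUS _ _, h2⟩
  have sig0 : ∀ y1 y2, schCol hS (i y1) (i y2) = iS (schCol hUS y1 y2) := by
    intro y1 y2
    obtain ⟨h1, h2⟩ := hiS _ (schCol_mem hUS y1 y2)
    rw [schCol_eq hS h1]
    exact h2 (y1, y2) (mem_schCol hUS _ _)
  have hF : ∀ y, ∃ F : Sch.X ≃ Sch.X,
      (∀ z, schCol hS (i y) (F z) = schCol hS (i U.base) z) ∧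
      (y = U.base → ∀ z, F z = z) := by
    intro y
    by_cases hy : y = U.base
    · subst hy
      exact ⟨Equiv.refl _, fun _ => rfl, fun _ _ => rfl⟩
    · obtain ⟨F, hF⟩ := schCol_equiv hS (i U.base) (i y)
      exact ⟨F, hF, fun h => absurd h hy⟩
  choose F hF hF0 using hF
  have blF : ∀ y z, bl z = U.base ↔ bl (F y z) = y := by
    intro y z
    have h1 := bl_iff (i U.base) z
    have h2 := bl_iff (i y) (F y z)
    rw [bl_i] at h1 h2
    rw [eq_comm, h1, eq_comm, h2, hF]
  have mem_base : ∀ z, z ∈ coset Tt Sch.base ↔ bl z = U.base := by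
    intro z
    rw [mem_coset_iff hS hTt, ← bl_iff, ← hibase, bl_i, eq_comm]
  have hh : ∀ x, ∃ z, bl z = U.base ∧ g z = x := by
    intro x
    obtain ⟨z, hz, hz'⟩ := gbij.2.2 (Set.mem_univ x)
    exact ⟨z, (mem_base z).1 hz, hz'⟩
  choose h hhb hg using hh
  have ginj : ∀ z z', bl z = U.base → bl z' = U.base → g z = g z' → z = z' := by
    intro z z' h1 h2 h3
    exact gbij.2.1 ((mem_base z).2 h1) ((mem_base z').2 h2) h3
  have h_base : h T.base = i U.base := by
    refine ginj _ _ (hhb _) (bl_i _) ?_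
    rw [hg, hibase]
    exact gbase.symm
  have gcol : ∀ z1 z2 z1' z2', bl z1 = U.base → bl z2 = U.base → bl z1' = U.base →
      bl z2' = U.base → schCol hS z1 z2 = schCol hS z1' z2' →
      schCol hTS (g z1) (g z2) = schCol hTS (g z1') (g z2') := by
    intro z1 z2 z1' z2' b1 b2 b1' b2' hc
    obtain ⟨t, ht, m1, m2⟩ := gmor _ ⟨schCol hS z1 z2, (bl_iff _ _).1 (b1.trans b2.symm), rfl⟩
      (z1, z2) ⟨mem_schCol hS _ _, (mem_base _).2 b1, (mem_base _).2 b2⟩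
      (z1', z2') ⟨by rw [hc]; exact mem_schCol hS _ _, (mem_base _).2 b1', (mem_base _).2 b2'⟩
    rw [(schCol_eq hTS ht).2 m1, (schCol_eq hTS ht).2 m2]
  have gcol' : ∀ z1 z2 z1' z2', bl z1 = U.base → bl z2 = U.base → bl z1' = U.base →
      bl z2' = U.base → schCol hTS (g z1) (g z2) = schCol hTS (g z1') (g z2') →
      schCol hS z1 z2 = schCol hS z1' z2' := by
    intro z1 z2 z1' z2' b1 b2 b1' b2' hc
    have hm : ∀ p q, bl p = U.base → bl q = U.base →
        elemMapsTo g (schCol hS p q ∩ (coset Tt Sch.base ×ˢ coset Tt Sch.base))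
          (schCol hTS (g p) (g q)) := by
      rintro p q hp hq ⟨r, s⟩ ⟨hw1, hw2, hw3⟩
      have hr := (mem_base r).1 hw2
      have hs := (mem_base s).1 hw3
      rw [← schCol_eq hTS (schCol_mem hTS _ _)]
      exact gcol _ _ _ _ hr hs hp hq ((schCol_eq hS (schCol_mem hS _ _)).2 hw1)
    have e1 := hm z1 z2 b1 b2
    have e2 := hm z1' z2' b1' b2'
    rw [← hc] at e2
    have e3 := (grel _ (schCol_mem hTS (g z1) (g z2))).unique
      ⟨⟨_, (bl_iff _ _).1 (b1.trans b2.symm), rfl⟩, e1⟩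
      ⟨⟨_, (bl_iff _ _).1 (b1'.trans b2'.symm), rfl⟩, e2⟩
    have m : (z1', z2') ∈ schCol hS z1' z2' ∩ (coset Tt Sch.base ×ˢ coset Tt Sch.base) :=
      ⟨mem_schCol hS _ _, (mem_base _).2 b1', (mem_base _).2 b2'⟩
    rw [← e3] at m
    exact ((schCol_eq hS (schCol_mem hS _ _)).2 m.1).symm
  let K : Ctx Sch.X U.X T.X (Set (Sch.X × Sch.X)) (Set (U.X × U.X)) :=
    { col := schCol hS
      uc := schCol hUS
      i := i
      bl := bl
      e := fun y x => F y (h x)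
      ei := fun z => g ((F (bl z)).symm z)
      x0 := T.base
      col_refl := fun a b => ((schCol_diag hS).2 rfl).trans ((schCol_diag hS).2 rfl).symm
      col_diag := fun a b c hc => (schCol_diag hS).1 (hc.trans ((schCol_diag hS).2 rfl))
      col_symm := schCol_symm hS
      count := schCol_count hS
      transfer := schCol_transfer hS
      bl_i := bl_i
      bl_col := by
        intro a b a' b' hc hb
        rw [bl_iff] at hb ⊢
        rwa [← hc]
      uc_col := uc_col
      sig := by
        intro y1 y2 y1' y2' hu
        rw [sig0, sig0, hu]
      star := by
        intro a w b a' w' b' h1 h2 h3 h4 h5 h6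
        rw [sig0] at h4 h5
        rw [← h6] at h5
        rw [bl_iff] at h1 h2
        have hu := schCol_mem hUS (bl w) (bl b)
        have hm : ∀ p q r, schCol hS p q = schCol hS a w →
            schCol hS q r = iS (schCol hUS (bl w) (bl b)) →
            schCol hS p r ∈ cmulS Sch.S (schCol hS a w) (iS (schCol hUS (bl w) (bl b))) := by
          intro p q r e1 e2
          rw [mem_cmulS hS (schCol_mem hS _ _) (hiS _ hu).1]
          refine ⟨schCol_mem hS _ _, (p, r), mem_schCol hS _ _, q, ?_, ?_⟩
          · rw [← e1]
            exact mem_schCol hS _ _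
          · rw [← e2]
            exact mem_schCol hS _ _
        exact (hcond _ hu _ h1).unique (hm a w b rfl h4) (hm a' w' b' h3.symm h5)
      bl_e := fun y x => (blF y (h x)).1 (hhb x)
      ei_e := by
        intro y x
        have : bl (F y (h x)) = y := (blF y (h x)).1 (hhb x)
        simp only [this, Equiv.symm_apply_apply, hg]
      e_ei := by
        intro z
        have h1 : bl ((F (bl z)).symm z) = U.base := by
          rw [blF (bl z), Equiv.apply_symm_apply]
        have h2 : h (g ((F (bl z)).symm z)) = (F (bl z)).symm z :=
          ginj _ _ (hhb _) h1 (hg _)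
        simp only [h2, Equiv.apply_symm_apply]
      e_base := by
        intro y
        have h1 := hF y (i U.base)
        rw [(schCol_diag hS).2 (rfl : i U.base = i U.base), schCol_diag] at h1
        simp only [h_base]
        exact h1.symm }
  have hT : T.S = relsOf (K.c U.base) := by
    rw [← relsOf_schCol hTS]
    apply relsOf_congr
    intro a b a' b'
    have hc : ∀ a b, K.c U.base a b = schCol hS (h a) (h b) := by
      intro a b
      change schCol hS (F U.base (h a)) (F U.base (h b)) = _
      rw [hF0 _ rfl, hF0 _ rfl]
    rw [hc, hc]
    constructor
    · intro he
      apply gcol' _ _ _ _ (hhb _) (hhb _) (hhb _) (hhb _)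
      simpa only [hg] using he
    · intro he
      have := gcol _ _ _ _ (hhb _) (hhb _) (hhb _) (hhb _) he
      simpa only [hg] using this
  have hU : ∀ u ∈ U.S, ∀ y1 y2 y1' y2', (y1, y2) ∈ u → (y1', y2') ∈ u →
      K.uc y1 y2 = K.uc y1' y2' := by
    intro u hu y1 y2 y1' y2' h1 h2
    exact ((schCol_eq hUS hu).2 h1).trans ((schCol_eq hUS hu).2 h2).symm
  have hU1 : ∀ u ∈ U.S, ∀ y1 y2 y1' y2', (y1, y2) ∈ u → K.uc y1 y2 = K.uc y1' y2' →
      (y1', y2') ∈ u := by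
    intro u hu y1 y2 y1' y2' h1 h2
    rw [← schCol_eq hUS hu] at h1 ⊢
    exact (Eq.symm h2).trans h1
  refine ⟨K.action rfl hT hU, fun z => (K.bl z, K.ei z), ?_⟩
  have := K.sdp_iso rfl hT hU hU1
  rw [show relsOf K.col = Sch.S from relsOf_schCol hS, show K.i U.base = Sch.base from hibase]
    at this
  exact this
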